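/- In the setting of the main theorem (quaternary (V,φ) over a number field, h with φ[h]=q≠0, W=(Fh)^⊥, ψ=φ|_W, L a g-maximal lattice in V, 𝔬 = A⁺(L∩W)): the map N ↦ A⁺(N) gives a bijection of the set of SO^ψ(W)-classes contained in the SO^ψ(W)-genus of L∩W onto the set of conjugacy classes (under A⁺(W)×) contained in the genus of 𝔬. -/

import Mathlib

noncomputable section

namespace Paper

variable (R F : Type*) [CommRing R] [Field F] [Algebra R F]

section Lattices

variable (W : Type*) [AddCommGroup W] [Module F W] [Module R W] [IsScalarTower R F W]

/-- A `g`-lattice in `W`: a finitely generated `R`-submodule containing an `F`-basis. -/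
def IsLat (L : Submodule R W) : Prop :=
  L.FG ∧ Submodule.span F (L : Set W) = ⊤

/-- integral lattice with respect to a bilinear form -/
def IsIntegralLat (ψ : LinearMap.BilinForm F W) (L : Submodule R W) : Prop :=
  IsLat R F W L ∧ ∀ x ∈ L, ψ x x ∈ (algebraMap R F).range

/-- maximal lattice with respect to a bilinear form -/
def IsMaximalLat (ψ : LinearMap.BilinForm F W) (L : Submodule R W) : Prop :=
  IsIntegralLat R F W ψ L ∧ ∀ L' : Submodule R W, IsIntegralLat R F W ψ L' → L ≤ L' → L' = L

/-- the ideal `[L/M]` generated by determinants of `F`-automorphisms carrying `L` into `M` -/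
def latIdx (L M : Submodule R W) : Submodule R F :=
  Submodule.span R {d : F | ∃ α : W ≃ₗ[F] W, (∀ x ∈ L, α x ∈ M) ∧
    LinearMap.det (α : W →ₗ[F] W) = d}

/-- the dual lattice `L~ = {x | 2ψ(x,L) ⊆ g}` -/
def dualLat (ψ : LinearMap.BilinForm F W) (L : Submodule R W) : Submodule R W :=
  ⨅ y ∈ L, Submodule.comap (((2 : F) • (ψ.flip y)).restrictScalars R)
    (LinearMap.range (Algebra.linearMap R F))

/-- the ideal `[L/M]` for lattices spanning the subspace `U`, computed inside `U` -/
def latIdxIn (U : Submodule F W) (L M : Submodule R W) : Submodule R F :=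
  latIdx R F ↥U (Submodule.comap ((U.subtype).restrictScalars R) L)
    (Submodule.comap ((U.subtype).restrictScalars R) M)

/-- product of a fractional ideal and a lattice -/
def idSMul {M : Type*} [AddCommGroup M] [Module F M] [Module R M] [IsScalarTower R F M]
    (I : Submodule R F) (N : Submodule R M) : Submodule R M :=
  Submodule.span R {z : M | ∃ c ∈ I, ∃ x ∈ N, z = c • x}

end Lattices

/-- the fractional ideal attached to an integral ideal -/
def idealToF (I : Ideal R) : Submodule R F :=
  Submodule.map (Algebra.linearMap R F) I

section Clifford

variable (W : Type*) [AddCommGroup W] [Module F W] [Module R W] [IsScalarTower R F W]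
variable (Q : QuadraticForm F W)

/-- the order `A(N)` generated by `g` and `N` in the Clifford algebra -/
def cliffordOrder (N : Submodule R W) : Subalgebra R (CliffordAlgebra Q) :=
  Algebra.adjoin R (CliffordAlgebra.ι Q '' (N : Set W))

/-- the even Clifford algebra, as an `R`-subalgebra -/
def evenR : Subalgebra R (CliffordAlgebra Q) :=
  (CliffordAlgebra.even Q).restrictScalars R

/-- `A⁺(N) = A⁺(W) ∩ A(N)` -/
def APlus (N : Submodule R W) : Subalgebra R (CliffordAlgebra Q) :=
  evenR R F W Q ⊓ cliffordOrder R F W Q N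

def APlusSub (N : Submodule R W) : Submodule R (CliffordAlgebra Q) :=
  Subalgebra.toSubmodule (APlus R F W Q N)

def oneLat : Submodule R (CliffordAlgebra Q) :=
  LinearMap.range (Algebra.linearMap R (CliffordAlgebra Q))

/-- the `R`-linear map `x ↦ 2ν(x,y) = x·y* + y·x*`, where `*` is the canonical
involution (reversal) of the Clifford algebra -/
def traceMap (y : CliffordAlgebra Q) : CliffordAlgebra Q →ₗ[R] CliffordAlgebra Q :=
  ((LinearMap.mulRight F (CliffordAlgebra.reverse (Q := Q) y)) +
    (LinearMap.mulLeft F y) ∘ₗ (CliffordAlgebra.reverse (Q := Q))).restrictScalars R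

/-- the dual `o~ = {x ∈ A⁺(W) | 2ν(x,o) ⊆ g}` with respect to the norm form
`ν[x] = x x*` of the even Clifford algebra -/
def normDual (o : Submodule R (CliffordAlgebra Q)) : Submodule R (CliffordAlgebra Q) :=
  Subalgebra.toSubmodule (evenR R F W Q) ⊓
    ⨅ y ∈ o, Submodule.comap (traceMap R F W Q y) (oneLat R F W Q)

/-- `A⁺(W)° = {x ∈ A⁺(W) | x* = -x}`, as an `R`-submodule -/
def minusPart : Submodule R (CliffordAlgebra Q) :=
  Subalgebra.toSubmodule (evenR R F W Q) ⊓
    LinearMap.ker ((CliffordAlgebra.reverse (Q := Q) + LinearMap.id).restrictScalars R)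

end Clifford

end Paper

namespace Paper

section Orders

variable (R F : Type*) [CommRing R] [Field F] [Algebra R F]
variable (A : Type*) [Ring A] [Algebra F A] [Algebra R A] [IsScalarTower R F A]

/-- an order in the `F`-subalgebra `B` of `A`: an `R`-subalgebra which is an `R`-lattice
in `B` -/
def IsOrderIn (B : Subalgebra F A) (o : Subalgebra R A) : Prop :=
  (Subalgebra.toSubmodule o).FG ∧ (o : Set A) ⊆ (B : Set A) ∧
    Submodule.span F (o : Set A) = Subalgebra.toSubmodule B

/-- a maximal order in `B` -/
def IsMaximalOrderIn (B : Subalgebra F A) (o : Subalgebra R A) : Prop :=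
  IsOrderIn R F A B o ∧ ∀ o' : Subalgebra R A, IsOrderIn R F A B o' → o ≤ o' → o' = o

end Orders

section Abbrev

variable (R F : Type*) [CommRing R] [Field F] [Algebra R F]
variable (W : Type*) [AddCommGroup W] [Module F W] [Module R W] [IsScalarTower R F W]
variable (psi : LinearMap.BilinForm F W)

/-- the ideal `[A⁺(M)/A⁺(N)]`, computed inside the quaternion algebra `A⁺(W)` -/
def APlusIdx (M N : Submodule R W) : Submodule R F :=
  latIdxIn R F (CliffordAlgebra (LinearMap.BilinMap.toQuadraticMap psi))
    (Subalgebra.toSubmodule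
      (CliffordAlgebra.even (LinearMap.BilinMap.toQuadraticMap psi)))
    (APlusSub R F W (LinearMap.BilinMap.toQuadraticMap psi) M)
    (APlusSub R F W (LinearMap.BilinMap.toQuadraticMap psi) N)

/-- the ideal `[A⁺(N)~/A⁺(N)]`, computed inside the quaternion algebra `A⁺(W)` -/
def APlusDualIdx (N : Submodule R W) : Submodule R F :=
  latIdxIn R F (CliffordAlgebra (LinearMap.BilinMap.toQuadraticMap psi))
    (Subalgebra.toSubmodule
      (CliffordAlgebra.even (LinearMap.BilinMap.toQuadraticMap psi)))
    (normDual R F W (LinearMap.BilinMap.toQuadraticMap psi)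
      (APlusSub R F W (LinearMap.BilinMap.toQuadraticMap psi) N))
    (APlusSub R F W (LinearMap.BilinMap.toQuadraticMap psi) N)

/-- the fractional ideal `2⁻¹·[Ñ/N]` -/
def halfDualIdx (N : Submodule R W) : Submodule R F :=
  Submodule.span R {((2 : F)⁻¹)} * latIdx R F W (dualLat R F W psi N) N

end Abbrev

end Paper

namespace Paper

section SOConj

variable (R F : Type*) [CommRing R] [Field F] [Algebra R F]
variable (W : Type*) [AddCommGroup W] [Module F W] [Module R W] [IsScalarTower R F W]

/-- membership in the special orthogonal group `SO^ψ` -/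
def IsSOElem (ψ : LinearMap.BilinForm F W) (γ : W ≃ₗ[F] W) : Prop :=
  (∀ x y, ψ (γ x) (γ y) = ψ x y) ∧ LinearMap.det (γ : W →ₗ[F] W) = 1

/-- the (right) action of `γ` on lattices -/
def latAction (γ : W ≃ₗ[F] W) (N : Submodule R W) : Submodule R W :=
  Submodule.map ((γ : W →ₗ[F] W).restrictScalars R) N

variable (Q : QuadraticForm F W)

/-- a unit of the even Clifford algebra `A⁺(W)`, i.e. of the even Clifford group
`G⁺(W)` (for ternary spaces `G⁺(W) = A⁺(W)ˣ`) -/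
def IsGPlusUnit (α : (CliffordAlgebra Q)ˣ) : Prop :=
  ((α : CliffordAlgebra Q) ∈ CliffordAlgebra.even Q) ∧
    (((α⁻¹ : (CliffordAlgebra Q)ˣ) : CliffordAlgebra Q) ∈ CliffordAlgebra.even Q)

/-- conjugation `x ↦ α⁻¹ x α` as an `R`-linear map -/
def conjMap (α : (CliffordAlgebra Q)ˣ) : CliffordAlgebra Q →ₗ[R] CliffordAlgebra Q :=
  ((LinearMap.mulLeft F (((α⁻¹ : (CliffordAlgebra Q)ˣ) : CliffordAlgebra Q))).comp
    (LinearMap.mulRight F (α : CliffordAlgebra Q))).restrictScalars R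

/-- `γ = τ(α)`: the automorphism `γ` of `W` is induced by conjugation by `α` via the
homomorphism `τ : G⁺(W) → SO^ψ`, `x·τ(α) = α⁻¹ x α`. -/
def IsTau (γ : W ≃ₗ[F] W) (α : (CliffordAlgebra Q)ˣ) : Prop :=
  ∀ x : W, CliffordAlgebra.ι Q (γ x) =
    ((α⁻¹ : (CliffordAlgebra Q)ˣ) : CliffordAlgebra Q) * CliffordAlgebra.ι Q x *
      (α : CliffordAlgebra Q)

end SOConj

section Genus

open IsDedekindDomain

variable (R F : Type*) [CommRing R] [IsDedekindDomain R] [Field F] [Algebra R F]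
variable (W : Type*) [AddCommGroup W] [Module F W] [Module R W] [IsScalarTower R F W]

/-- the localization `N_(v)` of an `R`-submodule `N` at a finite prime `v`,
taken inside the ambient vector space -/
def localAt (v : HeightOneSpectrum R) (N : Submodule R W) : Submodule R W where
  carrier := {x | ∃ s : R, s ∉ v.asIdeal ∧ s • x ∈ N}
  zero_mem' := ⟨1, fun hmem =>
    v.isPrime.ne_top (Ideal.eq_top_of_isUnit_mem _ hmem isUnit_one), by
      simp⟩
  add_mem' := by
    rintro x y ⟨s, hs, hsx⟩ ⟨t, ht, hty⟩
    refine ⟨s * t, fun hmem => ?_, ?_⟩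
    · rcases v.isPrime.mem_or_mem hmem with hmem | hmem
      exacts [hs hmem, ht hmem]
    · have hx' : (s * t) • x ∈ N := by
        rw [mul_comm, mul_smul]; exact N.smul_mem t hsx
      have hy' : (s * t) • y ∈ N := by
        rw [mul_smul]; exact N.smul_mem s hty
      simpa [smul_add] using N.add_mem hx' hy'
  smul_mem' := by
    rintro r x ⟨s, hs, hsx⟩
    exact ⟨s, hs, by rw [smul_comm]; exact N.smul_mem r hsx⟩

/-- `N` belongs to the `SO^ψ`-genus of `L0`: at every finite prime the localizations
are carried into each other by an element of the special orthogonal group. -/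
def InGenus (ψ : LinearMap.BilinForm F W) (L0 N : Submodule R W) : Prop :=
  ∀ v : HeightOneSpectrum R, ∃ γ : W ≃ₗ[F] W, IsSOElem F W ψ γ ∧
    latAction R F W γ (localAt R W v N) = localAt R W v L0

variable (Q : QuadraticForm F W)

/-- `o` belongs to the genus `{β⁻¹ o0 β | β ∈ A⁺(W)ˣ_𝐀}` of the order `o0` -/
def OrderInGenus (o0 o : Submodule R (CliffordAlgebra Q)) : Prop :=
  ∀ v : HeightOneSpectrum R, ∃ α : (CliffordAlgebra Q)ˣ, IsGPlusUnit F W Q α ∧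
    Submodule.map (conjMap R F W Q α) (localAt R (CliffordAlgebra Q) v o0) =
      localAt R (CliffordAlgebra Q) v o

end Genus

end Paper

namespace Paper

open IsDedekindDomain Module

section Localization

variable {R : Type*} [CommRing R] [IsDedekindDomain R]
variable {W : Type*} [AddCommGroup W] [Module R W]

lemma notMem_mul {v : HeightOneSpectrum R} {s t : R} (hs : s ∉ v.asIdeal) (ht : t ∉ v.asIdeal) :
    s * t ∉ v.asIdeal := fun h => (v.isPrime.mem_or_mem h).elim hs ht

lemma one_notMem (v : HeightOneSpectrum R) : (1 : R) ∉ v.asIdeal :=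
  (Ideal.ne_top_iff_one _).1 v.isPrime.ne_top

lemma le_localAt (v : HeightOneSpectrum R) (N : Submodule R W) : N ≤ localAt R W v N :=
  fun x hx => ⟨1, one_notMem v, by simpa using hx⟩

lemma localAt_le_of_le {v : HeightOneSpectrum R} {N N' : Submodule R W}
    (h : N ≤ localAt R W v N') : localAt R W v N ≤ localAt R W v N' := by
  rintro x ⟨s, hs, hx⟩
  obtain ⟨t, ht, hx'⟩ := h hx
  exact ⟨t * s, notMem_mul ht hs, by rwa [mul_smul]⟩

/-- A submodule of a module over a Dedekind domain that is not a field is determined by its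
localizations at the nonzero primes. -/
lemma eq_of_localAt_eq (hR : ¬ IsField R) {N N' : Submodule R W}
    (h : ∀ v : HeightOneSpectrum R, localAt R W v N = localAt R W v N') : N = N' := by
  have key : ∀ {N N' : Submodule R W},
      (∀ v : HeightOneSpectrum R, localAt R W v N = localAt R W v N') → N ≤ N' := by
    intro N N' h x hx
    let I : Ideal R := N'.comap (LinearMap.toSpanSingleton R W x)
    by_contra hxN
    have hI : I ≠ ⊤ := fun hI => hxN <| by
      have : (1 : R) ∈ I := hI ▸ Submodule.mem_top
      simpa [I] using this
    obtain ⟨m, hm, hIm⟩ := Ideal.exists_le_maximal I hI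
    let v : HeightOneSpectrum R :=
      ⟨m, hm.isPrime, Ring.ne_bot_of_isMaximal_of_not_isField hm hR⟩
    have hxv : x ∈ localAt R W v N' := h v ▸ le_localAt v N hx
    obtain ⟨s, hs, hsx⟩ := hxv
    exact hs (hIm (by simpa [I] using hsx))
  exact le_antisymm (key h) (key fun v => (h v).symm)

lemma localAt_map (v : HeightOneSpectrum R) {W' : Type*} [AddCommGroup W'] [Module R W']
    (g : W →ₗ[R] W') (hg : Function.Bijective g) (N : Submodule R W) :
    localAt R W' v (N.map g) = (localAt R W v N).map g := by
  ext x
  constructor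
  · rintro ⟨s, hs, hx⟩
    obtain ⟨y, rfl⟩ := hg.2 x
    rw [← map_smul, Submodule.mem_map] at hx
    obtain ⟨z, hz, hzy⟩ := hx
    exact ⟨y, ⟨s, hs, hg.1 hzy ▸ hz⟩, rfl⟩
  · rintro ⟨y, ⟨s, hs, hy⟩, rfl⟩
    exact ⟨s, hs, by rw [← map_smul]; exact Submodule.mem_map_of_mem hy⟩

/-- A finitely generated submodule of a localized submodule has a common denominator. -/
lemma exists_smul_le_of_fg {v : HeightOneSpectrum R} {N N' : Submodule R W} (hN : N.FG)
    (h : N ≤ localAt R W v N') : ∃ s : R, s ∉ v.asIdeal ∧ ∀ x ∈ N, s • x ∈ N' := by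
  induction N, hN using Submodule.fg_induction with
  | singleton x =>
    obtain ⟨s, hs, hx⟩ := h (Submodule.mem_span_singleton_self x)
    refine ⟨s, hs, fun y hy => ?_⟩
    obtain ⟨r, rfl⟩ := Submodule.mem_span_singleton.1 hy
    rw [smul_comm]
    exact N'.smul_mem r hx
  | sup M₁ M₂ _ _ h₁ h₂ =>
    obtain ⟨s, hs, hsx⟩ := h₁ (le_sup_left.trans h)
    obtain ⟨t, ht, htx⟩ := h₂ (le_sup_right.trans h)
    refine ⟨s * t, notMem_mul hs ht, fun x hx => ?_⟩
    obtain ⟨y, hy, z, hz, rfl⟩ := Submodule.mem_sup.1 hx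
    rw [smul_add]
    refine add_mem ?_ ?_
    · rw [mul_comm, mul_smul]; exact N'.smul_mem t (hsx y hy)
    · rw [mul_smul]; exact N'.smul_mem s (htx z hz)

variable (F : Type*) [Field F] [Algebra R F] [IsFractionRing R F]

/-- The local ring at `v`, as a subring of the fraction field. -/
def locRing (v : HeightOneSpectrum R) : Subalgebra R F :=
  Localization.subalgebra.ofField F v.asIdeal.primeCompl v.asIdeal.primeCompl_le_nonZeroDivisors

instance (v : HeightOneSpectrum R) :
    IsLocalization v.asIdeal.primeCompl (locRing F v) :=
  Localization.subalgebra.isLocalization_ofField F _ _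

instance (v : HeightOneSpectrum R) : IsFractionRing (locRing F v) F :=
  Localization.subalgebra.isFractionRing_ofField F _ _

instance (v : HeightOneSpectrum R) : IsPrincipalIdealRing (locRing F v) := by
  have : IsDiscreteValuationRing (locRing F v) :=
    IsLocalization.AtPrime.isDiscreteValuationRing_of_dedekind_domain R v.ne_bot _
  infer_instance

variable {F}

lemma mem_locRing {v : HeightOneSpectrum R} {c : F} :
    c ∈ locRing F v ↔ ∃ s : R, s ∉ v.asIdeal ∧ ∃ r : R, algebraMap R F s * c = algebraMap R F r := by
  have h0 : ∀ {s : R}, s ∉ v.asIdeal → algebraMap R F s ≠ 0 := fun {s} hs h =>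
    hs (by rw [(IsFractionRing.injective R F) (h.trans (map_zero _).symm)]; exact zero_mem _)
  constructor
  · rintro ⟨a, s, hs, rfl⟩
    refine ⟨s, hs, a, ?_⟩
    field_simp [h0 hs]
  · rintro ⟨s, hs, r, h⟩
    refine ⟨r, s, hs, ?_⟩
    rw [← h]
    field_simp [h0 hs]

variable [Module F W] [IsScalarTower R F W]

lemma smul_mem_localAt {v : HeightOneSpectrum R} {N : Submodule R W} {c : F}
    (hc : c ∈ locRing F v) {x : W} (hx : x ∈ localAt R W v N) : c • x ∈ localAt R W v N := by
  obtain ⟨s, hs, r, h⟩ := mem_locRing.1 hc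
  obtain ⟨t, ht, hx⟩ := hx
  refine ⟨s * t, notMem_mul hs ht, ?_⟩
  have : (s * t) • c • x = r • t • x := by
    rw [← algebraMap_smul F (s * t), ← algebraMap_smul F r, ← algebraMap_smul F t, smul_smul,
      smul_smul, ← h, map_mul]
    ring_nf
  rw [this]
  exact N.smul_mem r hx

/-- A lattice over a Dedekind domain is locally free. -/
lemma exists_local_basis (v : HeightOneSpectrum R) {n : ℕ} (hn : finrank F W = n)
    [FiniteDimensional F W] {L : Submodule R W} (hL : IsLat R F W L) :
    ∃ f : Basis (Fin n) F W, (∀ i, f i ∈ localAt R W v L) ∧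
      ∀ x ∈ localAt R W v L, ∀ i, f.repr x i ∈ locRing F v := by
  let S := locRing F v
  let M : Submodule S W := Submodule.span S (L : Set W)
  have hM : ∀ x, x ∈ M ↔ x ∈ localAt R W v L := by
    intro x
    constructor
    · intro hx
      induction hx using Submodule.span_induction with
      | mem x hx => exact le_localAt v L hx
      | zero => exact zero_mem _
      | add x y _ _ hx hy => exact add_mem hx hy
      | smul c x _ hx => exact smul_mem_localAt c.2 hx
    · rintro ⟨s, hs, hx⟩
      have hs' : (algebraMap R F s)⁻¹ ∈ S :=
        mem_locRing.2 ⟨s, hs, 1, by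
          rw [mul_inv_cancel₀, map_one]
          intro h
          exact hs (by rw [(IsFractionRing.injective R F) (h.trans (map_zero _).symm)]
                       exact zero_mem _)⟩
      have h2 := M.smul_mem ⟨_, hs'⟩ (Submodule.subset_span hx)
      have h0 : algebraMap R F s ≠ 0 := fun h =>
        hs (by rw [(IsFractionRing.injective R F) (h.trans (map_zero _).symm)]; exact zero_mem _)
      have : (⟨_, hs'⟩ : S) • s • x = x := by
        rw [← algebraMap_smul F s, Subalgebra.smul_def, smul_smul, inv_mul_cancel₀ h0, one_smul]
      rwa [this] at h2
  have hlat : Submodule.IsLattice F M := by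
    obtain ⟨⟨X, hX⟩, hsp⟩ := hL
    refine ⟨⟨X, ?_⟩, ?_⟩
    · rw [show M = Submodule.span S (L : Set W) from rfl, ← hX]
      exact (Submodule.span_span_of_tower R S (X : Set W)).symm
    · rw [Submodule.span_span_of_tower]; exact hsp
  have := Submodule.IsLattice.free (K := F) M
  have : Module.Finite S M := Submodule.IsLattice.finite F M
  let b := Module.Free.chooseBasis S M
  let f₀ := b.extendOfIsLattice F
  have hcard : Fintype.card (Free.ChooseBasisIndex S M) = n := by
    rw [← hn, finrank_eq_card_basis f₀]
  let e := Fintype.equivFinOfCardEq hcard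
  refine ⟨f₀.reindex e, fun i => ?_, fun x hx i => ?_⟩
  · rw [Basis.reindex_apply, Basis.extendOfIsLattice_apply]
    exact (hM _).1 (b _).2
  · have hx' := (hM x).2 hx
    have : f₀.repr x (e.symm i) = (b.repr ⟨x, hx'⟩ (e.symm i) : F) := by
      have h1 : x = ∑ j, ((b.repr ⟨x, hx'⟩ j : S) : F) • f₀ j := by
        have h2 := congrArg Subtype.val (b.sum_repr ⟨x, hx'⟩)
        rw [Submodule.coe_sum] at h2
        refine h2.symm.trans (Finset.sum_congr rfl fun j _ => ?_)
        rw [Basis.extendOfIsLattice_apply]; rfl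
      conv_lhs => rw [h1, Basis.repr_sum_self]
    rw [Basis.repr_reindex_apply, this]
    exact SetLike.coe_mem _

end Localization

end Paper

namespace Paper

open Module

section TernaryAlgebra

variable {T A : Type*} [CommRing T] [Ring A] [Algebra T A]

/-- The span of the even monomials in three generators. -/
def evenSpan (T : Type*) {A : Type*} [CommRing T] [Ring A] [Algebra T A] (u v w : A) :
    Submodule T A := Submodule.span T {1, u * v, u * w, v * w}

/-- The span of the odd monomials in three generators. -/
def oddSpan (T : Type*) {A : Type*} [CommRing T] [Ring A] [Algebra T A] (u v w : A) :
    Submodule T A := Submodule.span T {u, v, w, u * v * w}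

lemma mem_evenSpan {u v w x : A} : x ∈ evenSpan T u v w ↔
    ∃ a b c d : T, x = a • (1 : A) + b • (u * v) + c • (u * w) + d • (v * w) := by
  simp only [evenSpan, Submodule.mem_span_insert, Submodule.mem_span_singleton]
  constructor
  · rintro ⟨a, _, ⟨b, _, ⟨c, _, ⟨d, rfl⟩, rfl⟩, rfl⟩, rfl⟩
    exact ⟨a, b, c, d, by abel⟩
  · rintro ⟨a, b, c, d, rfl⟩
    exact ⟨a, _, ⟨b, _, ⟨c, _, ⟨d, rfl⟩, rfl⟩, rfl⟩, by abel⟩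

lemma mem_oddSpan {u v w x : A} : x ∈ oddSpan T u v w ↔
    ∃ a b c d : T, x = a • u + b • v + c • w + d • (u * v * w) := by
  simp only [oddSpan, Submodule.mem_span_insert, Submodule.mem_span_singleton]
  constructor
  · rintro ⟨a, _, ⟨b, _, ⟨c, _, ⟨d, rfl⟩, rfl⟩, rfl⟩, rfl⟩
    exact ⟨a, b, c, d, by abel⟩
  · rintro ⟨a, b, c, d, rfl⟩
    exact ⟨a, _, ⟨b, _, ⟨c, _, ⟨d, rfl⟩, rfl⟩, rfl⟩, by abel⟩

variable {u v w : A} {q₁ q₂ q₃ t₁₂ t₁₃ t₂₃ : T}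

lemma generator_mul_mem (hu : u * u = q₁ • 1) (hv : v * v = q₂ • 1) (hw : w * w = q₃ • 1)
    (huv : v * u = t₁₂ • 1 - u * v) (huw : w * u = t₁₃ • 1 - u * w)
    (hvw : w * v = t₂₃ • 1 - v * w) {g : A} (hg : g ∈ ({u, v, w} : Set A)) {x : A}
    (hx : x ∈ evenSpan T u v w ⊔ oddSpan T u v w) :
    g * x ∈ evenSpan T u v w ⊔ oddSpan T u v w := by
  have hu' : ∀ y, u * (u * y) = q₁ • y := fun y => by rw [← mul_assoc, hu, smul_mul_assoc, one_mul]
  have hv' : ∀ y, v * (v * y) = q₂ • y := fun y => by rw [← mul_assoc, hv, smul_mul_assoc, one_mul]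
  have huv' : ∀ y, v * (u * y) = t₁₂ • y - u * (v * y) := fun y => by
    rw [← mul_assoc, huv, sub_mul, smul_mul_assoc, one_mul, mul_assoc]
  have huw' : ∀ y, w * (u * y) = t₁₃ • y - u * (w * y) := fun y => by
    rw [← mul_assoc, huw, sub_mul, smul_mul_assoc, one_mul, mul_assoc]
  have hvw' : ∀ y, w * (v * y) = t₂₃ • y - v * (w * y) := fun y => by
    rw [← mul_assoc, hvw, sub_mul, smul_mul_assoc, one_mul, mul_assoc]
  obtain ⟨e, he, o, ho, rfl⟩ := Submodule.mem_sup.1 hx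
  obtain ⟨a, b, c, d, rfl⟩ := mem_evenSpan.1 he
  obtain ⟨a', b', c', d', rfl⟩ := mem_oddSpan.1 ho
  rw [mul_add, add_comm]
  rcases hg with rfl | rfl | rfl
  · refine Submodule.add_mem_sup
      (mem_evenSpan.2 ⟨q₁ * a', b', c', d' * q₁, ?_⟩)
      (mem_oddSpan.2 ⟨a, b * q₁, c * q₁, d, ?_⟩)
    all_goals
      simp only [mul_add, mul_smul_comm, mul_assoc, hu, hu', mul_one]
      try module
  · refine Submodule.add_mem_sup
      (mem_evenSpan.2 ⟨a' * t₁₂ + b' * q₂, -a', - d' * q₂, c' + d' * t₁₂, ?_⟩)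
      (mem_oddSpan.2 ⟨- b * q₂, a + b * t₁₂, c * t₁₂ + d * q₂, -c, ?_⟩)
    all_goals
      simp only [mul_add, mul_smul_comm, mul_assoc, huv, huv', hv, hv', mul_one]
      module
  · refine Submodule.add_mem_sup
      (mem_evenSpan.2 ⟨a' * t₁₃ + b' * t₂₃ + c' * q₃, d' * q₃, -a' - d' * t₂₃,
        -b' + d' * t₁₃, ?_⟩)
      (mem_oddSpan.2 ⟨- b * t₂₃ - c * q₃, b * t₁₃ - d * q₃, a + c * t₁₃ + d * t₂₃, b, ?_⟩)
    all_goals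
      simp only [mul_add, mul_sub, mul_smul_comm, mul_assoc, huw, huw', hvw, hvw', hw, mul_one]
      module

/-- The algebra generated by three elements satisfying Clifford relations is spanned by the
ordered monomials. -/
lemma adjoin_le_evenSpan_sup_oddSpan (hu : u * u = q₁ • 1) (hv : v * v = q₂ • 1)
    (hw : w * w = q₃ • 1) (huv : v * u = t₁₂ • 1 - u * v) (huw : w * u = t₁₃ • 1 - u * w)
    (hvw : w * v = t₂₃ • 1 - v * w) {x : A} (hx : x ∈ Algebra.adjoin T ({u, v, w} : Set A)) :
    x ∈ evenSpan T u v w ⊔ oddSpan T u v w := by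
  suffices H : ∀ y ∈ evenSpan T u v w ⊔ oddSpan T u v w,
      x * y ∈ evenSpan T u v w ⊔ oddSpan T u v w by
    have := H 1 (Submodule.mem_sup_left (Submodule.subset_span (by simp)))
    rwa [mul_one] at this
  induction hx using Algebra.adjoin_induction with
  | mem g hg => exact fun y hy => generator_mul_mem hu hv hw huv huw hvw hg hy
  | algebraMap r =>
    intro y hy
    rw [← Algebra.smul_def]
    exact Submodule.smul_mem _ r hy
  | add a b _ _ ha hb =>
    intro y hy
    rw [add_mul]
    exact add_mem (ha y hy) (hb y hy)
  | mul a b _ _ ha hb =>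
    intro y hy
    rw [mul_assoc]
    exact ha _ (hb _ hy)

end TernaryAlgebra

section Alternating

open CliffordAlgebra

variable {F : Type*} [Field F] {W : Type*} [AddCommGroup W] [Module F W] (Q : QuadraticForm F W)

/-- The alternating map `(x, y, w) ↦ x y w - w y x` into the Clifford algebra. -/
def tripleAlt : W [⋀^Fin 3]→ₗ[F] CliffordAlgebra Q where
  toFun x := ι Q (x 0) * ι Q (x 1) * ι Q (x 2) - ι Q (x 2) * ι Q (x 1) * ι Q (x 0)
  map_update_add' := by
    intro d m i x y
    have : d = instDecidableEqFin 3 := Subsingleton.elim _ _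
    subst this
    fin_cases i <;> simp <;> noncomm_ring
  map_update_smul' := by
    intro d m i c x
    have : d = instDecidableEqFin 3 := Subsingleton.elim _ _
    subst this
    fin_cases i <;> simp [smul_sub]
  map_eq_zero_of_eq' := by
    intro m i j hm hij
    have comm : ∀ (r : F) (a : CliffordAlgebra Q), algebraMap F _ r * a = a * algebraMap F _ r :=
      fun r a => Algebra.commutes r a
    fin_cases i <;> fin_cases j <;> simp at hm hij ⊢ <;> simp [hm, mul_assoc, ι_sq_scalar] <;>
      simp [comm]

variable {Q}

lemma tripleAlt_apply (x y w : W) :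
    tripleAlt Q ![x, y, w] = ι Q x * ι Q y * ι Q w - ι Q w * ι Q y * ι Q x := rfl

lemma tripleAlt_eq_det_smul (e : Basis (Fin 3) F W) (m : Fin 3 → W) :
    tripleAlt Q m = e.det m • tripleAlt Q e := by
  have : tripleAlt Q = (LinearMap.toSpanSingleton F _ (tripleAlt Q e)).compAlternatingMap e.det := by
    refine Basis.ext_alternating e fun v hv => ?_
    obtain ⟨σ, rfl⟩ : ∃ σ : Equiv.Perm (Fin 3), v = σ :=
      ⟨Equiv.ofBijective v (Finite.injective_iff_bijective.1 hv), rfl⟩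
    have h1 := (tripleAlt Q).map_perm e σ
    have h2 := e.det.map_perm e σ
    simp only [Function.comp_def] at h1 h2
    simp [h1, h2, e.det_self]
  exact congrArg (fun g => g m) this

/-- The commutator of two products of vectors sharing the first factor. -/
lemma commutator_mul_mul (x y w : W) :
    (ι Q x * ι Q y) * (ι Q x * ι Q w) - (ι Q x * ι Q w) * (ι Q x * ι Q y) =
      - ι Q x * tripleAlt Q ![x, y, w] := by
  have h : ι Q y * ι Q x = algebraMap F _ (QuadraticMap.polar Q y x) - ι Q x * ι Q y :=
    ι_mul_ι_comm y x
  have h' : ι Q x * ι Q y = algebraMap F _ (QuadraticMap.polar Q y x) - ι Q y * ι Q x := by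
    rw [h]; abel
  have hc := Algebra.commutes (QuadraticMap.polar Q y x) (ι Q w)
  rw [tripleAlt_apply, mul_assoc (ι Q x) (ι Q y), ← mul_assoc (ι Q y), h, mul_assoc (ι Q x) (ι Q w),
    ← mul_sub, sub_mul, hc]
  nth_rw 2 [h']
  noncomm_ring

end Alternating

end Paper

namespace Paper

open Module CliffordAlgebra

section Ternary

variable {F : Type*} [Field F] {W : Type*} [AddCommGroup W] [Module F W]
variable {Q : QuadraticForm F W}

lemma clifford_ι_injective [CharZero F] : Function.Injective (ι Q) := by
  have : Invertible (2 : F) := invertibleOfNonzero two_ne_zero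
  intro x y h
  have h' : ∀ z, equivExterior Q (ι Q z) = ExteriorAlgebra.ι F z := fun z =>
    changeForm_ι changeForm.associated_neg_proof z
  have := congrArg (equivExterior Q) h
  rw [h', h'] at this
  exact (ExteriorAlgebra.ι_inj F x y).1 this

lemma clifford_algebraMap_injective [CharZero F] :
    Function.Injective (algebraMap F (CliffordAlgebra Q)) := by
  have : Invertible (2 : F) := invertibleOfNonzero two_ne_zero
  exact FaithfulSMul.algebraMap_injective F _

/-- An orthogonal basis consisting of anisotropic vectors. -/
structure IsOrthogonalBasis (Q : QuadraticForm F W) (e : Basis (Fin 3) F W) : Prop where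
  polar_eq_zero : ∀ i j, i ≠ j → QuadraticMap.polar Q (e i) (e j) = 0
  ne_zero : ∀ i, Q (e i) ≠ 0

/-- The product of the vectors of a basis. -/
def volElem (Q : QuadraticForm F W) (e : Basis (Fin 3) F W) : CliffordAlgebra Q :=
  ι Q (e 0) * ι Q (e 1) * ι Q (e 2)

lemma ι_mul_ι_swap_of_polar {x y : W} (h : QuadraticMap.polar Q x y = 0) :
    ι Q x * ι Q y = - (ι Q y * ι Q x) := by
  rw [ι_mul_ι_comm, h, map_zero, zero_sub]

/-- Any element of the Clifford algebra is the sum of an even and an odd combination of the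
monomials in a basis, with coefficients in a subring containing the relevant structure
constants. -/
lemma mem_evenSpan_of_mem_even {T : Type*} [CommRing T] [Algebra T F]
    [Module T W] [IsScalarTower T F W]
    {f : Fin 3 → W} (hq : ∀ i, ∃ q : T, algebraMap T F q = Q (f i))
    (ht : ∀ i j, ∃ t : T, algebraMap T F t = QuadraticMap.polar Q (f i) (f j))
    {x : CliffordAlgebra Q} (hx : x ∈ Algebra.adjoin T (ι Q '' Set.range f)) :
    (x ∈ evenOdd Q 0 → x ∈ evenSpan T (ι Q (f 0)) (ι Q (f 1)) (ι Q (f 2))) ∧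
    (x ∈ evenOdd Q 1 → x ∈ oddSpan T (ι Q (f 0)) (ι Q (f 1)) (ι Q (f 2))) := by
  have hset : ι Q '' Set.range f = {ι Q (f 0), ι Q (f 1), ι Q (f 2)} := by
    ext y
    simp [Fin.exists_fin_succ, eq_comm]
  choose q hq using hq
  choose t ht using ht
  rw [hset] at hx
  have hsq : ∀ i, ι Q (f i) * ι Q (f i) = q i • (1 : CliffordAlgebra Q) := fun i => by
    rw [ι_sq_scalar, ← hq, Algebra.algebraMap_eq_smul_one, algebraMap_smul]
  have hsw : ∀ i j, ι Q (f i) * ι Q (f j) = t i j • (1 : CliffordAlgebra Q) - ι Q (f j) * ι Q (f i) :=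
    fun i j => by
      rw [ι_mul_ι_comm, ← ht, Algebra.algebraMap_eq_smul_one, algebraMap_smul]
  have key := adjoin_le_evenSpan_sup_oddSpan (hsq 0) (hsq 1) (hsq 2) (hsw 1 0) (hsw 2 0) (hsw 2 1) hx
  obtain ⟨a, ha, b, hb, rfl⟩ := Submodule.mem_sup.1 key
  have smul_mem : ∀ (i : ZMod 2) (r : T) {z}, z ∈ evenOdd Q i → r • z ∈ evenOdd Q i :=
    fun i r z hz => by
      rw [← algebraMap_smul F r]
      exact Submodule.smul_mem _ _ hz
  have ha0 : a ∈ evenOdd Q 0 := by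
    obtain ⟨a, b, c, d, rfl⟩ := mem_evenSpan.1 ha
    refine add_mem (add_mem (add_mem ?_ ?_) ?_) ?_ <;> apply smul_mem
    · exact SetLike.GradedOne.one_mem
    all_goals exact ι_mul_ι_mem_evenOdd_zero _ _ _
  have hb1 : b ∈ evenOdd Q 1 := by
    obtain ⟨a, b, c, d, rfl⟩ := mem_oddSpan.1 hb
    refine add_mem (add_mem (add_mem ?_ ?_) ?_) ?_ <;> apply smul_mem
    iterate 3 exact ι_mem_evenOdd_one _ _
    have := SetLike.mul_mem_graded (A := evenOdd Q) (ι_mul_ι_mem_evenOdd_zero Q (f 0) (f 1))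
      (ι_mem_evenOdd_one Q (f 2))
    simpa using this
  have hdisj : ∀ z, z ∈ evenOdd Q 0 → z ∈ evenOdd Q 1 → z = 0 := fun z h0 h1 =>
    (Submodule.disjoint_def.1 (evenOdd_isCompl Q).disjoint) z h0 h1
  constructor
  · intro h
    have : b = 0 := hdisj b (by simpa using sub_mem h ha0) hb1
    rwa [this, add_zero]
  · intro h
    have : a = 0 := hdisj a ha0 (by simpa using sub_mem h hb1)
    rwa [this, zero_add]

lemma mem_adjoin_basis (e : Basis (Fin 3) F W) (x : CliffordAlgebra Q) :
    x ∈ Algebra.adjoin F (ι Q '' Set.range e) := by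
  have : Algebra.adjoin F (ι Q '' Set.range e) = ⊤ := by
    rw [eq_top_iff, ← adjoin_range_ι]
    refine Algebra.adjoin_le ?_
    rintro _ ⟨y, rfl⟩
    rw [← e.sum_repr y, map_sum]
    refine sum_mem fun i _ => ?_
    rw [map_smul]
    exact Subalgebra.smul_mem _ (Algebra.subset_adjoin (Set.mem_image_of_mem _ (Set.mem_range_self i))) _
  rw [this]
  trivial

lemma exists_even_eq (e : Basis (Fin 3) F W) {x : CliffordAlgebra Q} (hx : x ∈ evenOdd Q 0) :
    ∃ a b c d : F, x = a • (1 : CliffordAlgebra Q) + b • (ι Q (e 0) * ι Q (e 1)) +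
      c • (ι Q (e 0) * ι Q (e 2)) + d • (ι Q (e 1) * ι Q (e 2)) :=
  mem_evenSpan.1 ((mem_evenSpan_of_mem_even (fun _ => ⟨_, rfl⟩) (fun _ _ => ⟨_, rfl⟩)
    (mem_adjoin_basis e x)).1 hx)

lemma exists_odd_eq (e : Basis (Fin 3) F W) {x : CliffordAlgebra Q} (hx : x ∈ evenOdd Q 1) :
    ∃ a b c d : F, x = a • ι Q (e 0) + b • ι Q (e 1) +
      c • ι Q (e 2) + d • volElem Q e :=
  mem_oddSpan.1 ((mem_evenSpan_of_mem_even (fun _ => ⟨_, rfl⟩) (fun _ _ => ⟨_, rfl⟩)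
    (mem_adjoin_basis e x)).2 hx)

namespace IsOrthogonalBasis

variable {e : Basis (Fin 3) F W} (he : IsOrthogonalBasis Q e)
include he

lemma anticomm {i j : Fin 3} (h : i ≠ j) : ι Q (e i) * ι Q (e j) = - (ι Q (e j) * ι Q (e i)) :=
  ι_mul_ι_swap_of_polar (he.polar_eq_zero i j h)

lemma reverse_volElem : reverse (volElem Q e) = - volElem Q e := by
  simp only [volElem, reverse.map_mul, reverse_ι]
  rw [← mul_assoc, he.anticomm (i := 2) (j := 1) (by decide), neg_mul, mul_assoc,
    he.anticomm (i := 2) (j := 0) (by decide), mul_neg, neg_neg, ← mul_assoc,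
    he.anticomm (i := 1) (j := 0) (by decide), neg_mul]

lemma tripleAlt_eq : tripleAlt Q e = (2 : F) • volElem Q e := by
  have : tripleAlt Q e = volElem Q e - reverse (volElem Q e) := by
    simp only [volElem, reverse.map_mul, reverse_ι, ← mul_assoc]
    rfl
  rw [this, he.reverse_volElem]
  module

lemma tripleAlt_eq_smul (m : Fin 3 → W) : tripleAlt Q m = (2 * e.det m) • volElem Q e := by
  rw [tripleAlt_eq_det_smul e, he.tripleAlt_eq, smul_smul, mul_comm]

lemma volElem_mul_ι (i : Fin 3) : volElem Q e * ι Q (e i) = ι Q (e i) * volElem Q e := by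
  have h10 := he.anticomm (i := 1) (j := 0) (by decide)
  have h20 := he.anticomm (i := 2) (j := 0) (by decide)
  have h21 := he.anticomm (i := 2) (j := 1) (by decide)
  have h10' : ∀ y, ι Q (e 1) * (ι Q (e 0) * y) = -(ι Q (e 0) * (ι Q (e 1) * y)) := fun y => by
    rw [← mul_assoc, h10, neg_mul, mul_assoc]
  have h20' : ∀ y, ι Q (e 2) * (ι Q (e 0) * y) = -(ι Q (e 0) * (ι Q (e 2) * y)) := fun y => by
    rw [← mul_assoc, h20, neg_mul, mul_assoc]
  have h21' : ∀ y, ι Q (e 2) * (ι Q (e 1) * y) = -(ι Q (e 1) * (ι Q (e 2) * y)) := fun y => by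
    rw [← mul_assoc, h21, neg_mul, mul_assoc]
  fin_cases i <;>
    simp [volElem, mul_assoc, h20, h21, h10', h20', h21']

lemma volElem_comm (x : CliffordAlgebra Q) : volElem Q e * x = x * volElem Q e := by
  have hx := mem_adjoin_basis e x
  induction hx using Algebra.adjoin_induction with
  | mem g hg =>
    obtain ⟨_, ⟨i, rfl⟩, rfl⟩ := hg
    exact he.volElem_mul_ι i
  | algebraMap r => exact (Algebra.commutes r _).symm
  | add a b _ _ ha hb => rw [mul_add, add_mul, ha, hb]
  | mul a b _ _ ha hb => rw [← mul_assoc, ha, mul_assoc, hb, mul_assoc]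

/-- The square of the volume element. -/
lemma volElem_sq : volElem Q e * volElem Q e =
    algebraMap F _ (- (Q (e 0) * Q (e 1) * Q (e 2))) := by
  have h : volElem Q e * volElem Q e = - (volElem Q e * reverse (volElem Q e)) := by
    rw [he.reverse_volElem, mul_neg, neg_neg]
  rw [h]
  simp only [volElem, reverse.map_mul, reverse_ι]
  have : ι Q (e 0) * ι Q (e 1) * ι Q (e 2) * (ι Q (e 2) * (ι Q (e 1) * ι Q (e 0))) =
      ι Q (e 0) * (ι Q (e 1) * (ι Q (e 2) * ι Q (e 2)) * ι Q (e 1)) * ι Q (e 0) := by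
    noncomm_ring
  rw [this, ι_sq_scalar, ← Algebra.commutes (Q (e 2)), mul_assoc _ (ι Q (e 1)), ι_sq_scalar,
    ← map_mul, ← Algebra.commutes, mul_assoc, ι_sq_scalar, ← map_mul, ← map_neg]
  congr 1
  ring

lemma volElem_ne_zero [CharZero F] : volElem Q e ≠ 0 := by
  intro h
  have h2 := he.volElem_sq
  rw [h, mul_zero] at h2
  have := clifford_algebraMap_injective (h2.symm.trans (map_zero _).symm)
  simp [he.ne_zero] at this

omit he in
lemma volElem_mem : volElem Q e ∈ evenOdd Q 1 := by
  have := SetLike.mul_mem_graded (A := evenOdd Q) (ι_mul_ι_mem_evenOdd_zero Q (e 0) (e 1))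
      (ι_mem_evenOdd_one Q (e 2))
  simpa [volElem] using this

/-- An even element that is fixed by reversal is a scalar. -/
lemma exists_algebraMap_of_reverse [CharZero F] {x : CliffordAlgebra Q} (hx : x ∈ evenOdd Q 0)
    (hr : reverse x = x) : ∃ a : F, x = algebraMap F _ a := by
  obtain ⟨a, b, c, d, rfl⟩ := exists_even_eq e hx
  simp only [map_add, map_smul, reverse.map_mul, reverse_ι, reverse.map_one,
    he.anticomm (i := 1) (j := 0) (by decide), he.anticomm (i := 2) (j := 0) (by decide),
    he.anticomm (i := 2) (j := 1) (by decide)] at hr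
  refine ⟨a, ?_⟩
  rw [Algebra.algebraMap_eq_smul_one]
  set X := ι Q (e 0) * ι Q (e 1)
  set Y := ι Q (e 0) * ι Q (e 2)
  set Z := ι Q (e 1) * ι Q (e 2)
  have : (2 : F) • (b • X + c • Y + d • Z) = 0 := by
    rw [← sub_eq_zero] at hr
    rw [← neg_eq_zero, ← hr]
    module
  have := (smul_eq_zero.1 this).resolve_left two_ne_zero
  rw [add_assoc, add_assoc, ← add_assoc (b • X), this, add_zero]

/-- An odd element that is fixed by reversal is a vector. -/
lemma exists_ι_of_reverse [CharZero F] {x : CliffordAlgebra Q} (hx : x ∈ evenOdd Q 1)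
    (hr : reverse x = x) : ∃ y, ι Q y = x := by
  obtain ⟨a, b, c, d, rfl⟩ := exists_odd_eq e hx
  simp only [map_add, map_smul, reverse_ι, he.reverse_volElem] at hr
  have : (2 : F) • (d • volElem Q e) = 0 := by
    rw [← sub_eq_zero] at hr
    rw [← neg_eq_zero, ← hr]
    module
  have := (smul_eq_zero.1 this).resolve_left two_ne_zero
  exact ⟨a • e 0 + b • e 1 + c • e 2, by simp [this]⟩

end IsOrthogonalBasis

end Ternary

end Paper

namespace Paper

open Module CliffordAlgebra

section Versor

variable {F : Type*} [Field F] {W : Type*} [AddCommGroup W] [Module F W]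
variable {Q : QuadraticForm F W}

/-- A homogeneous unit of the Clifford algebra that normalizes the space of vectors. -/
structure IsVersor (α : (CliffordAlgebra Q)ˣ) : Prop where
  homogeneous : ∃ i : ZMod 2, (α : CliffordAlgebra Q) ∈ evenOdd Q i ∧
    ((α⁻¹ : (CliffordAlgebra Q)ˣ) : CliffordAlgebra Q) ∈ evenOdd Q i
  exists_conj : ∀ x, ∃ y, ι Q y * α = α * ι Q x

lemma IsVersor.mul {α β : (CliffordAlgebra Q)ˣ} (hα : IsVersor α) (hβ : IsVersor β) :
    IsVersor (α * β) := by
  obtain ⟨i, hi, hi'⟩ := hα.homogeneous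
  obtain ⟨j, hj, hj'⟩ := hβ.homogeneous
  refine ⟨⟨i + j, ?_, ?_⟩, fun x => ?_⟩
  · rw [Units.val_mul]
    exact SetLike.mul_mem_graded hi hj
  · rw [mul_inv_rev, Units.val_mul, add_comm]
    exact SetLike.mul_mem_graded hj' hi'
  · obtain ⟨y, hy⟩ := hβ.exists_conj x
    obtain ⟨z, hz⟩ := hα.exists_conj y
    refine ⟨z, ?_⟩
    rw [Units.val_mul, ← mul_assoc, hz, mul_assoc, hy, mul_assoc]

/-- An anisotropic vector as a unit of the Clifford algebra. -/
def vectorUnit (u : W) (hu : Q u ≠ 0) : (CliffordAlgebra Q)ˣ where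
  val := ι Q u
  inv := (Q u)⁻¹ • ι Q u
  val_inv := by
    rw [mul_smul_comm, ι_sq_scalar, Algebra.algebraMap_eq_smul_one, smul_smul,
      inv_mul_cancel₀ hu, one_smul]
  inv_val := by
    rw [smul_mul_assoc, ι_sq_scalar, Algebra.algebraMap_eq_smul_one, smul_smul,
      inv_mul_cancel₀ hu, one_smul]

lemma isVersor_vectorUnit (u : W) (hu : Q u ≠ 0) : IsVersor (vectorUnit u hu) := by
  refine ⟨⟨1, ι_mem_evenOdd_one _ _, Submodule.smul_mem _ _ (ι_mem_evenOdd_one _ _)⟩, fun x => ?_⟩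
  refine ⟨(QuadraticMap.polar Q u x * (Q u)⁻¹) • u - x, ?_⟩
  change ι Q _ * ι Q u = ι Q u * ι Q x
  rw [map_sub, sub_mul, map_smul, smul_mul_assoc, ι_sq_scalar, Algebra.algebraMap_eq_smul_one,
    smul_smul, mul_assoc, inv_mul_cancel₀ hu, mul_one, ← Algebra.algebraMap_eq_smul_one,
    ← ι_mul_ι_add_swap]
  abel

variable {e : Basis (Fin 3) F W}

/-- The volume element of an orthogonal basis as a unit of the Clifford algebra. -/
def volUnit (he : IsOrthogonalBasis Q e) : (CliffordAlgebra Q)ˣ where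
  val := volElem Q e
  inv := (- (Q (e 0) * Q (e 1) * Q (e 2)))⁻¹ • volElem Q e
  val_inv := by
    rw [mul_smul_comm, he.volElem_sq, Algebra.algebraMap_eq_smul_one, smul_smul,
      inv_mul_cancel₀ (by simp [he.ne_zero]), one_smul]
  inv_val := by
    rw [smul_mul_assoc, he.volElem_sq, Algebra.algebraMap_eq_smul_one, smul_smul,
      inv_mul_cancel₀ (by simp [he.ne_zero]), one_smul]

/-- A triple of vectors with the same products as the orthogonal basis `e`, and the same
orientation. -/
structure IsAligned (Q : QuadraticForm F W) (e : Basis (Fin 3) F W) (g : Fin 3 → W) : Prop where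
  map_eq : ∀ i, Q (g i) = Q (e i)
  polar_eq_zero : ∀ i j, i ≠ j → QuadraticMap.polar Q (g i) (g j) = 0
  tripleAlt_eq : tripleAlt Q g = tripleAlt Q e

variable [CharZero F] (he : IsOrthogonalBasis Q e)
include he

lemma IsAligned.conj {g : Fin 3 → W} (hg : IsAligned Q e g) {α : (CliffordAlgebra Q)ˣ}
    (hα : IsVersor α) :
    ∃ g', IsAligned Q e g' ∧ ∀ i, ι Q (g' i) * α = α * ι Q (g i) := by
  choose g' hg' using fun i => hα.exists_conj (g i)
  have h2 : ∀ i j, ι Q (g' i) * ι Q (g' j) * α = α * (ι Q (g i) * ι Q (g j)) := fun i j => by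
    rw [mul_assoc, hg', ← mul_assoc, hg', mul_assoc]
  have h3 : ∀ i j k, ι Q (g' i) * ι Q (g' j) * ι Q (g' k) * α =
      α * (ι Q (g i) * ι Q (g j) * ι Q (g k)) := fun i j k => by
    rw [mul_assoc, hg', ← mul_assoc, h2, mul_assoc]
  refine ⟨g', ⟨fun i => ?_, fun i j hij => ?_, ?_⟩, hg'⟩
  · have := h2 i i
    rw [ι_sq_scalar, ι_sq_scalar, ← Algebra.commutes, Units.mul_left_inj] at this
    rw [clifford_algebraMap_injective this, hg.map_eq]
  · have := congrArg₂ (· + ·) (h2 i j) (h2 j i)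
    simp only [← add_mul, ← mul_add] at this
    rw [ι_mul_ι_add_swap, ι_mul_ι_add_swap, ← Algebra.commutes, Units.mul_left_inj] at this
    rw [clifford_algebraMap_injective this, hg.polar_eq_zero i j hij]
  · have := congrArg₂ (· - ·) (h3 0 1 2) (h3 2 1 0)
    simp only [← sub_mul, ← mul_sub] at this
    change tripleAlt Q g' * α = α * tripleAlt Q g at this
    rw [hg.tripleAlt_eq, he.tripleAlt_eq, mul_smul_comm, ← he.volElem_comm, ← smul_mul_assoc,
      ← he.tripleAlt_eq, Units.mul_left_inj] at this
    exact this

omit he in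
lemma ne_zero_or_ne_zero_of_map_eq {x y : W} (h : Q x = Q y) (hy : Q y ≠ 0) :
    Q (x + y) ≠ 0 ∨ Q (x - y) ≠ 0 := by
  by_contra! hc
  have h1 := QuadraticMap.map_add Q x y
  have h2 := QuadraticMap.map_add Q x (-y)
  rw [← sub_eq_add_neg, QuadraticMap.map_neg, QuadraticMap.polar_neg_right] at h2
  rw [hc.1] at h1
  rw [hc.2] at h2
  have : 4 * Q y = 0 := by linear_combination -h1 - h2 - 2 * h
  exact hy (by simpa using this)

omit [CharZero F] he in
lemma add_mul_eq {x y : W} (h : Q x = Q y) : ι Q y * ι Q (x + y) = ι Q (x + y) * ι Q x := by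
  rw [map_add, mul_add, add_mul, ι_sq_scalar, ι_sq_scalar, h, add_comm]

omit [CharZero F] he in
lemma sub_mul_eq {x y : W} (h : Q x = Q y) : ι Q y * ι Q (x - y) = - (ι Q (x - y) * ι Q x) := by
  rw [map_sub, mul_sub, sub_mul, ι_sq_scalar, ι_sq_scalar, h]
  abel

lemma IsAligned.exists_fix_zero {g : Fin 3 → W} (hg : IsAligned Q e g) :
    ∃ α : (CliffordAlgebra Q)ˣ, IsVersor α ∧ ι Q (e 0) * α = α * ι Q (g 0) := by
  rcases ne_zero_or_ne_zero_of_map_eq (hg.map_eq 0) (he.ne_zero 0) with h | h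
  · exact ⟨vectorUnit _ h, isVersor_vectorUnit _ h, add_mul_eq (hg.map_eq 0)⟩
  · refine ⟨vectorUnit (e 1) (he.ne_zero 1) * vectorUnit _ h,
      (isVersor_vectorUnit _ _).mul (isVersor_vectorUnit _ _), ?_⟩
    change ι Q (e 0) * (ι Q (e 1) * ι Q (g 0 - e 0)) = ι Q (e 1) * ι Q (g 0 - e 0) * ι Q (g 0)
    rw [← mul_assoc, he.anticomm (by decide), neg_mul, mul_assoc, sub_mul_eq (hg.map_eq 0), mul_neg,
      neg_neg, mul_assoc]

lemma IsAligned.exists_fix_one {g : Fin 3 → W} (hg : IsAligned Q e g) (h0 : g 0 = e 0) :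
    ∃ α : (CliffordAlgebra Q)ˣ, IsVersor α ∧ ι Q (e 0) * α = α * ι Q (e 0) ∧
      ι Q (e 1) * α = α * ι Q (g 1) := by
  have hp : QuadraticMap.polar Q (e 0) (g 1) = 0 := h0 ▸ hg.polar_eq_zero 0 1 (by decide)
  have hp' := he.polar_eq_zero 0 1 (by decide)
  have hadd : ι Q (e 0) * ι Q (g 1 + e 1) = - (ι Q (g 1 + e 1) * ι Q (e 0)) :=
    ι_mul_ι_swap_of_polar (by rw [QuadraticMap.polar_add_right, hp, hp', add_zero])
  have hsub : ι Q (e 0) * ι Q (g 1 - e 1) = - (ι Q (g 1 - e 1) * ι Q (e 0)) :=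
    ι_mul_ι_swap_of_polar (by rw [QuadraticMap.polar_sub_right, hp, hp', sub_zero])
  rcases ne_zero_or_ne_zero_of_map_eq (hg.map_eq 1) (he.ne_zero 1) with h | h
  · refine ⟨vectorUnit (e 1) (he.ne_zero 1) * vectorUnit _ h,
      (isVersor_vectorUnit _ _).mul (isVersor_vectorUnit _ _), ?_, ?_⟩
    · change ι Q (e 0) * (ι Q (e 1) * ι Q (g 1 + e 1)) = ι Q (e 1) * ι Q (g 1 + e 1) * ι Q (e 0)
      rw [← mul_assoc, he.anticomm (by decide), neg_mul, mul_assoc, hadd, mul_neg, neg_neg,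
        mul_assoc]
    · change ι Q (e 1) * (ι Q (e 1) * ι Q (g 1 + e 1)) = ι Q (e 1) * ι Q (g 1 + e 1) * ι Q (g 1)
      rw [mul_assoc, ← add_mul_eq (hg.map_eq 1)]
  · refine ⟨vectorUnit (e 2) (he.ne_zero 2) * vectorUnit _ h,
      (isVersor_vectorUnit _ _).mul (isVersor_vectorUnit _ _), ?_, ?_⟩
    · change ι Q (e 0) * (ι Q (e 2) * ι Q (g 1 - e 1)) = ι Q (e 2) * ι Q (g 1 - e 1) * ι Q (e 0)
      rw [← mul_assoc, he.anticomm (by decide), neg_mul, mul_assoc, hsub, mul_neg, neg_neg,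
        mul_assoc]
    · change ι Q (e 1) * (ι Q (e 2) * ι Q (g 1 - e 1)) = ι Q (e 2) * ι Q (g 1 - e 1) * ι Q (g 1)
      rw [← mul_assoc, he.anticomm (by decide), neg_mul, mul_assoc, sub_mul_eq (hg.map_eq 1),
        mul_neg, neg_neg, mul_assoc]

lemma IsAligned.eq_two {g : Fin 3 → W} (hg : IsAligned Q e g) (h0 : g 0 = e 0) (h1 : g 1 = e 1) :
    g 2 = e 2 := by
  have hrepr : ∀ x i, QuadraticMap.polar Q (e i) x = 2 * Q (e i) * e.repr x i := by
    intro x i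
    conv_lhs => rw [← e.sum_repr x]
    rw [← QuadraticMap.polarBilin_apply_apply, map_sum, Finset.sum_eq_single i]
    · rw [map_smul, QuadraticMap.polarBilin_apply_apply, QuadraticMap.polar_self, smul_eq_mul]
      simp [mul_comm]
    · intro j _ hj
      rw [map_smul, QuadraticMap.polarBilin_apply_apply, he.polar_eq_zero i j hj.symm, smul_zero]
    · simp
  have hz : ∀ i, i ≠ 2 → g i = e i → e.repr (g 2) i = 0 := fun i hi hgi => by
    have := hg.polar_eq_zero i 2 hi
    rw [hgi, hrepr] at this
    simpa [he.ne_zero] using this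
  have hg2 : g 2 = e.repr (g 2) 2 • e 2 := by
    conv_lhs => rw [← e.sum_repr (g 2)]
    rw [Fin.sum_univ_three, hz 0 (by decide) h0, hz 1 (by decide) h1]
    simp
  have ht : tripleAlt Q g = e.repr (g 2) 2 • tripleAlt Q e := by
    have hgv : tripleAlt Q g =
      ι Q (g 0) * ι Q (g 1) * ι Q (g 2) - ι Q (g 2) * ι Q (g 1) * ι Q (g 0) := rfl
    have hev : tripleAlt Q e =
      ι Q (e 0) * ι Q (e 1) * ι Q (e 2) - ι Q (e 2) * ι Q (e 1) * ι Q (e 0) := rfl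
    rw [hgv, hev, h0, h1, hg2]
    simp [smul_sub]
  have h2 : tripleAlt Q e ≠ 0 := by
    rw [he.tripleAlt_eq]
    exact smul_ne_zero two_ne_zero he.volElem_ne_zero
  rw [hg.tripleAlt_eq] at ht
  have hc : (e.repr (g 2) 2 - 1) • tripleAlt Q e = 0 := by
    rw [sub_smul, ← ht, one_smul, sub_self]
  rw [hg2, sub_eq_zero.1 ((smul_eq_zero.1 hc).resolve_right h2), one_smul]

lemma IsAligned.exists_versor {g : Fin 3 → W} (hg : IsAligned Q e g) :
    ∃ α : (CliffordAlgebra Q)ˣ, IsVersor α ∧ ∀ i, ι Q (e i) * α = α * ι Q (g i) := by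
  obtain ⟨α, hα, h0⟩ := hg.exists_fix_zero he
  obtain ⟨g', hg', hgg'⟩ := hg.conj he hα
  have h0' : g' 0 = e 0 := clifford_ι_injective
    ((Units.mul_left_inj α).1 ((hgg' 0).trans h0.symm))
  obtain ⟨β, hβ, h1, h2⟩ := hg'.exists_fix_one he h0'
  obtain ⟨g'', hg'', hgg''⟩ := hg'.conj he hβ
  have h0'' : g'' 0 = e 0 := clifford_ι_injective
    ((Units.mul_left_inj β).1 ((hgg'' 0).trans (by rw [h0', h1])))
  have h1'' : g'' 1 = e 1 := clifford_ι_injective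
    ((Units.mul_left_inj β).1 ((hgg'' 1).trans h2.symm))
  have h2'' := hg''.eq_two he h0'' h1''
  have hall : ∀ i, g'' i = e i := by
    intro i
    fin_cases i
    exacts [h0'', h1'', h2'']
  refine ⟨β * α, hβ.mul hα, fun i => ?_⟩
  rw [Units.val_mul, ← mul_assoc, ← hall i, hgg'', mul_assoc, hgg', mul_assoc]

/-- Every rotation is induced by conjugation with an even unit. -/
lemma exists_isTau {γ : W ≃ₗ[F] W} (hγ : ∀ x, Q (γ x) = Q x)
    (hdet : LinearMap.det (γ : W →ₗ[F] W) = 1) :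
    ∃ α : (CliffordAlgebra Q)ˣ, IsGPlusUnit F W Q α ∧ IsTau F W Q γ α := by
  have hg : IsAligned Q e (fun i => γ (e i)) := by
    refine ⟨fun i => hγ _, fun i j hij => ?_, ?_⟩
    · rw [QuadraticMap.polar, ← map_add, hγ, hγ, hγ]
      exact he.polar_eq_zero i j hij
    · have := e.det_comp (γ : W →ₗ[F] W) e
      rw [hdet, e.det_self, one_mul] at this
      rw [tripleAlt_eq_det_smul e]
      change e.det (γ ∘ e) • _ = _
      erw [this]
      rw [one_smul]
  obtain ⟨α, hα, h⟩ := hg.exists_versor he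
  have hx : ∀ x, ι Q x * α = α * ι Q (γ x) := by
    intro x
    rw [← e.sum_repr x]
    simp only [map_sum, map_smul, Finset.sum_mul, Finset.mul_sum, smul_mul_assoc, mul_smul_comm, h]
  have htau : IsTau F W Q γ α := fun x => by
    rw [mul_assoc, hx, Units.inv_mul_cancel_left]
  obtain ⟨i, hi, hi'⟩ := hα.homogeneous
  fin_cases i
  · exact ⟨α, ⟨hi, hi'⟩, htau⟩
  · refine ⟨α * volUnit he, ⟨?_, ?_⟩, fun x => ?_⟩
    · have := SetLike.mul_mem_graded (A := evenOdd Q) hi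
        (IsOrthogonalBasis.volElem_mem (Q := Q) (e := e))
      exact this
    · have h1 : ((volUnit he)⁻¹ : (CliffordAlgebra Q)ˣ).val ∈ evenOdd Q 1 :=
        Submodule.smul_mem _ _ IsOrthogonalBasis.volElem_mem
      have := SetLike.mul_mem_graded (A := evenOdd Q) h1 hi'
      rw [mul_inv_rev, Units.val_mul]
      exact this
    · rw [mul_inv_rev, Units.val_mul, Units.val_mul, htau x]
      have hz : ((volUnit he : (CliffordAlgebra Q)ˣ) : CliffordAlgebra Q) = volElem Q e := rfl
      have := he.volElem_comm (((α⁻¹ : (CliffordAlgebra Q)ˣ) : CliffordAlgebra Q) * ι Q x * α)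
      rw [← hz] at this
      rw [← Units.inv_mul_cancel_left (volUnit he) (_ * _ * _), this]
      simp only [mul_assoc]

/-- Conjugation by an even unit induces a rotation. -/
lemma exists_isTau_of_isGPlusUnit {α : (CliffordAlgebra Q)ˣ} (hα : IsGPlusUnit F W Q α) :
    ∃ γ : W ≃ₗ[F] W, (∀ x, Q (γ x) = Q x) ∧ LinearMap.det (γ : W →ₗ[F] W) = 1 ∧
      IsTau F W Q γ α := by
  have hα0 : (α : CliffordAlgebra Q) ∈ evenOdd Q 0 := hα.1
  have hα1 : ((α⁻¹ : (CliffordAlgebra Q)ˣ) : CliffordAlgebra Q) ∈ evenOdd Q 0 := hα.2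
  have hνmem : reverse (α : CliffordAlgebra Q) * α ∈ evenOdd Q 0 := by
    have := SetLike.mul_mem_graded (A := evenOdd Q) ((reverse_mem_evenOdd_iff Q).2 hα0) hα0
    simpa using this
  obtain ⟨ν, hν⟩ := he.exists_algebraMap_of_reverse hνmem
    (by rw [reverse.map_mul, reverse_reverse])
  have hrev : reverse (α : CliffordAlgebra Q) =
      ν • ((α⁻¹ : (CliffordAlgebra Q)ˣ) : CliffordAlgebra Q) := by
    rw [Algebra.smul_def, ← hν, Units.mul_inv_cancel_right]
  have hrev' : ν • reverse ((α⁻¹ : (CliffordAlgebra Q)ˣ) : CliffordAlgebra Q) = α := by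
    have h1 : reverse ((α⁻¹ : (CliffordAlgebra Q)ˣ) : CliffordAlgebra Q) *
        reverse (α : CliffordAlgebra Q) = 1 := by
      rw [← reverse.map_mul, Units.mul_inv, reverse.map_one]
    rw [hrev, mul_smul_comm, ← smul_mul_assoc] at h1
    rw [← one_mul (α : CliffordAlgebra Q), ← h1, Units.inv_mul_cancel_right]
  have hvec : ∀ x : W, ∃ y : W, ι Q y =
      ((α⁻¹ : (CliffordAlgebra Q)ˣ) : CliffordAlgebra Q) * ι Q x * α := by
    intro x
    refine he.exists_ι_of_reverse ?_ ?_
    · have := SetLike.mul_mem_graded (A := evenOdd Q)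
        (SetLike.mul_mem_graded (A := evenOdd Q) hα1 (ι_mem_evenOdd_one Q x)) hα0
      simpa using this
    · rw [reverse.map_mul, reverse.map_mul, reverse_ι, hrev, smul_mul_assoc, ← mul_smul_comm,
        ← mul_smul_comm, hrev', mul_assoc]
  choose g hg using hvec
  let g' : W →ₗ[F] W :=
    { toFun := g
      map_add' := fun x y => clifford_ι_injective (Q := Q) (by
        simp only [map_add, hg, mul_add, add_mul])
      map_smul' := fun c x => clifford_ι_injective (Q := Q) (by
        simp only [map_smul, hg, mul_smul_comm, smul_mul_assoc, RingHom.id_apply]) }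
  have hinj : Function.Injective g' := fun x y hxy => by
    have := congrArg (ι Q) hxy
    change ι Q (g x) = ι Q (g y) at this
    rw [hg, hg, Units.mul_left_inj, Units.mul_right_inj] at this
    exact clifford_ι_injective this
  have : FiniteDimensional F W := Module.Finite.of_basis e
  have hg' : ∀ x, LinearEquiv.ofInjectiveEndo g' hinj x = g x := fun x => rfl
  have hconj : ∀ a b : CliffordAlgebra Q,
      ((α⁻¹ : (CliffordAlgebra Q)ˣ) : CliffordAlgebra Q) * a * α *
        (((α⁻¹ : (CliffordAlgebra Q)ˣ) : CliffordAlgebra Q) * b * α) =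
      ((α⁻¹ : (CliffordAlgebra Q)ˣ) : CliffordAlgebra Q) * (a * b) * α := fun a b => by
    simp only [mul_assoc, Units.mul_inv_cancel_left]
  refine ⟨LinearEquiv.ofInjectiveEndo g' hinj, fun x => ?_, ?_, fun x => ?_⟩
  · apply clifford_algebraMap_injective (Q := Q)
    rw [← ι_sq_scalar, hg', hg, hconj, ι_sq_scalar, ← Algebra.commutes,
      Units.inv_mul_cancel_right]
  · have h1 : tripleAlt Q (fun i => g (e i)) = tripleAlt Q e := by
      have h2 : tripleAlt Q (fun i => g (e i)) =
          ((α⁻¹ : (CliffordAlgebra Q)ˣ) : CliffordAlgebra Q) * tripleAlt Q e * α := by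
        change ι Q (g (e 0)) * ι Q (g (e 1)) * ι Q (g (e 2)) -
          ι Q (g (e 2)) * ι Q (g (e 1)) * ι Q (g (e 0)) = _
        simp only [hg, hconj]
        rw [← sub_mul, ← mul_sub]
        rfl
      rw [h2, he.tripleAlt_eq, mul_smul_comm, ← he.volElem_comm, smul_mul_assoc,
        Units.inv_mul_cancel_right]
    have h2 := e.det_comp g' e
    rw [e.det_self, mul_one] at h2
    have h3 := he.tripleAlt_eq_smul (fun i => g (e i))
    change _ = (2 * e.det (g' ∘ e)) • _ at h3
    rw [h2, h1, he.tripleAlt_eq, ← sub_eq_zero, ← sub_smul] at h3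
    have h4 := (smul_eq_zero.1 h3).resolve_right he.volElem_ne_zero
    change LinearMap.det g' = 1
    have h5 : (2 : F) * (LinearMap.det g' - 1) = 0 := by linear_combination -h4
    exact sub_eq_zero.1 ((mul_eq_zero.1 h5).resolve_left two_ne_zero)
  · rw [hg', hg]

end Versor

end Paper

namespace Paper

open Module CliffordAlgebra IsDedekindDomain

section EvenOrder

variable {R F : Type*} [CommRing R] [IsDedekindDomain R] [Field F] [Algebra R F]
variable {W : Type*} [AddCommGroup W] [Module F W] [Module R W] [IsScalarTower R F W]
variable {Q : QuadraticForm F W}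

lemma mul_mem_localAt {A : Type*} [Ring A] [Algebra R A] {v : HeightOneSpectrum R}
    {B : Subalgebra R A} {a b : A} (ha : a ∈ localAt R A v (Subalgebra.toSubmodule B))
    (hb : b ∈ localAt R A v (Subalgebra.toSubmodule B)) :
    a * b ∈ localAt R A v (Subalgebra.toSubmodule B) := by
  obtain ⟨s, hs, ha⟩ := ha
  obtain ⟨t, ht, hb⟩ := hb
  refine ⟨s * t, notMem_mul hs ht, ?_⟩
  rw [← smul_mul_smul_comm]
  exact B.mul_mem ha hb

omit [IsDedekindDomain R] in
lemma mem_APlusSub {N : Submodule R W} {x : CliffordAlgebra Q} :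
    x ∈ APlusSub R F W Q N ↔ x ∈ evenOdd Q 0 ∧ x ∈ cliffordOrder R F W Q N := Iff.rfl

lemma cliffordOrder_le_localAt {v : HeightOneSpectrum R} {N N' : Submodule R W}
    (h : N ≤ localAt R W v N') {x : CliffordAlgebra Q} (hx : x ∈ cliffordOrder R F W Q N) :
    x ∈ localAt R (CliffordAlgebra Q) v (Subalgebra.toSubmodule (cliffordOrder R F W Q N')) := by
  induction hx using Algebra.adjoin_induction with
  | mem _ hg =>
    obtain ⟨y, hy, rfl⟩ := hg
    obtain ⟨s, hs, hsy⟩ := h hy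
    refine ⟨s, hs, ?_⟩
    rw [← LinearMap.map_smul_of_tower]
    exact Algebra.subset_adjoin ⟨_, hsy, rfl⟩
  | algebraMap r => exact le_localAt _ _ (Subalgebra.algebraMap_mem _ r)
  | add a b _ _ ha hb => exact add_mem ha hb
  | mul a b _ _ ha hb => exact mul_mem_localAt ha hb

omit [IsDedekindDomain R] in
lemma smul_mem_evenOdd {i : ZMod 2} (s : R) {x : CliffordAlgebra Q}
    (hx : x ∈ evenOdd Q i) : s • x ∈ evenOdd Q i := by
  rw [← algebraMap_smul F]
  exact Submodule.smul_mem _ _ hx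

lemma APlusSub_le_localAt {v : HeightOneSpectrum R} {N N' : Submodule R W}
    (h : N ≤ localAt R W v N') :
    APlusSub R F W Q N ≤ localAt R (CliffordAlgebra Q) v (APlusSub R F W Q N') := by
  intro x hx
  obtain ⟨s, hs, hsx⟩ := cliffordOrder_le_localAt h (mem_APlusSub.1 hx).2
  exact ⟨s, hs, mem_APlusSub.2 ⟨smul_mem_evenOdd s (mem_APlusSub.1 hx).1, hsx⟩⟩

/-- The localization of `A⁺(N)` depends only on the localization of `N`. -/
lemma localAt_APlusSub_congr {v : HeightOneSpectrum R} {N N' : Submodule R W}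
    (h : localAt R W v N = localAt R W v N') :
    localAt R (CliffordAlgebra Q) v (APlusSub R F W Q N) =
      localAt R (CliffordAlgebra Q) v (APlusSub R F W Q N') :=
  le_antisymm
    (localAt_le_of_le (APlusSub_le_localAt (h ▸ le_localAt v N)))
    (localAt_le_of_le (APlusSub_le_localAt (h ▸ le_localAt v N')))

omit [IsDedekindDomain R]

section Tau

variable {γ : W ≃ₗ[F] W} {α : (CliffordAlgebra Q)ˣ}

omit [Algebra R F] [Module R W] [IsScalarTower R F W] [CommRing R] in
lemma IsTau.symm (h : IsTau F W Q γ α) : IsTau F W Q γ.symm α⁻¹ := fun x => by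
  have := h (γ.symm x)
  rw [LinearEquiv.apply_symm_apply] at this
  rw [this, inv_inv]
  simp only [mul_assoc, Units.mul_inv, mul_one, Units.mul_inv_cancel_left]

omit [Algebra R F] [Module R W] [IsScalarTower R F W] [CommRing R] in
lemma IsGPlusUnit.inv (h : IsGPlusUnit F W Q α) : IsGPlusUnit F W Q α⁻¹ :=
  ⟨h.2, by rw [inv_inv]; exact h.1⟩

lemma conjMap_apply (x : CliffordAlgebra Q) : conjMap R F W Q α x =
    ((α⁻¹ : (CliffordAlgebra Q)ˣ) : CliffordAlgebra Q) * (x * α) := rfl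

lemma conjMap_mul (x y : CliffordAlgebra Q) :
    conjMap R F W Q α (x * y) = conjMap R F W Q α x * conjMap R F W Q α y := by
  simp only [conjMap_apply, mul_assoc, Units.mul_inv_cancel_left]

lemma conjMap_conjMap_inv (x : CliffordAlgebra Q) :
    conjMap R F W Q α (conjMap R F W Q α⁻¹ x) = x := by
  simp only [conjMap_apply, mul_assoc, inv_inv, Units.inv_mul_cancel_left, Units.inv_mul, mul_one]

lemma conjMap_inv_conjMap (x : CliffordAlgebra Q) :
    conjMap R F W Q α⁻¹ (conjMap R F W Q α x) = x := by
  simpa using conjMap_conjMap_inv (R := R) (α := α⁻¹) x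

lemma conjMap_bijective : Function.Bijective (conjMap R F W Q α) :=
  Function.bijective_iff_has_inverse.2 ⟨_, conjMap_inv_conjMap, conjMap_conjMap_inv⟩

lemma map_conjMap_inv (o : Submodule R (CliffordAlgebra Q)) :
    Submodule.map (conjMap R F W Q α⁻¹) (Submodule.map (conjMap R F W Q α) o) = o := by
  rw [← Submodule.map_comp]
  convert Submodule.map_id o
  ext x
  exact conjMap_inv_conjMap x

lemma latAction_bijective : Function.Bijective ((γ : W →ₗ[F] W).restrictScalars R) := γ.bijective

lemma latAction_symm_latAction (N : Submodule R W) :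
    latAction R F W γ.symm (latAction R F W γ N) = N := by
  unfold latAction
  rw [← Submodule.map_comp]
  convert Submodule.map_id N
  ext x
  exact γ.symm_apply_apply x

lemma conjMap_mem_cliffordOrder (h : IsTau F W Q γ α) {N : Submodule R W}
    {x : CliffordAlgebra Q} (hx : x ∈ cliffordOrder R F W Q N) :
    conjMap R F W Q α x ∈ cliffordOrder R F W Q (latAction R F W γ N) := by
  induction hx using Algebra.adjoin_induction with
  | mem _ hg =>
    obtain ⟨y, hy, rfl⟩ := hg
    rw [conjMap_apply, ← mul_assoc, ← h y]
    exact Algebra.subset_adjoin ⟨_, Submodule.mem_map_of_mem hy, rfl⟩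
  | algebraMap r =>
    rw [conjMap_apply, Algebra.commutes, Units.inv_mul_cancel_left]
    exact Subalgebra.algebraMap_mem _ r
  | add a b _ _ ha hb => rw [map_add]; exact add_mem ha hb
  | mul a b _ _ ha hb => rw [conjMap_mul]; exact mul_mem ha hb

lemma map_conjMap_APlusSub_le (h : IsTau F W Q γ α) (hα : IsGPlusUnit F W Q α)
    (N : Submodule R W) :
    Submodule.map (conjMap R F W Q α) (APlusSub R F W Q N) ≤
      APlusSub R F W Q (latAction R F W γ N) := by
  rintro _ ⟨x, hx, rfl⟩
  exact ⟨mul_mem (S := Subalgebra F (CliffordAlgebra Q)) hα.2 (mul_mem hx.1 hα.1),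
    conjMap_mem_cliffordOrder h hx.2⟩

/-- The formation of `A⁺(N)` is compatible with rotations. -/
lemma map_conjMap_APlusSub (h : IsTau F W Q γ α) (hα : IsGPlusUnit F W Q α)
    (N : Submodule R W) :
    Submodule.map (conjMap R F W Q α) (APlusSub R F W Q N) =
      APlusSub R F W Q (latAction R F W γ N) := by
  refine le_antisymm (map_conjMap_APlusSub_le h hα N) fun x hx => ?_
  have := map_conjMap_APlusSub_le h.symm hα.inv _ (Submodule.mem_map_of_mem hx)
  rw [latAction_symm_latAction] at this
  exact ⟨_, this, conjMap_conjMap_inv x⟩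

end Tau

/-- The localized form of the compatibility of `A⁺` with rotations. -/
lemma localAt_APlusSub_eq_map [IsDedekindDomain R]
    {γ : W ≃ₗ[F] W} {α : (CliffordAlgebra Q)ˣ} (h : IsTau F W Q γ α)
    (hα : IsGPlusUnit F W Q α) {v : HeightOneSpectrum R} {N N' : Submodule R W}
    (hN : localAt R W v N' = latAction R F W γ (localAt R W v N)) :
    localAt R (CliffordAlgebra Q) v (APlusSub R F W Q N') =
      Submodule.map (conjMap R F W Q α) (localAt R (CliffordAlgebra Q) v (APlusSub R F W Q N)) := by
  have hN' : localAt R W v N' = localAt R W v (latAction R F W γ N) :=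
    hN.trans (localAt_map v _ latAction_bijective N).symm
  rw [localAt_APlusSub_congr hN', ← map_conjMap_APlusSub h hα]
  exact localAt_map v (conjMap R F W Q α) conjMap_bijective _

section Vectors

/-- The module of vectors `x` for which `ι x` is a multiple, with coefficient in `I`, of the
product of `Z` with a commutator of elements of `o`. -/
def commutatorVectors (I : Set F) (Z : CliffordAlgebra Q)
    (o : Submodule R (CliffordAlgebra Q)) : Submodule R W :=
  Submodule.span R {x | ∃ c ∈ I, ∃ a ∈ o, ∃ b ∈ o, ι Q x = c • (Z * (a * b - b * a))}

variable {I : Set F} {Z : CliffordAlgebra Q}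

lemma commutatorVectors_le_localAt [IsDedekindDomain R] {v : HeightOneSpectrum R}
    {o o' : Submodule R (CliffordAlgebra Q)} (h : o ≤ localAt R (CliffordAlgebra Q) v o') :
    commutatorVectors I Z o ≤ localAt R W v (commutatorVectors I Z o') := by
  refine Submodule.span_le.2 ?_
  rintro x ⟨c, hc, a, ha, b, hb, hx⟩
  obtain ⟨s, hs, hsa⟩ := h ha
  obtain ⟨t, ht, htb⟩ := h hb
  refine ⟨s * t, notMem_mul hs ht, Submodule.subset_span ⟨c, hc, _, hsa, _, htb, ?_⟩⟩
  rw [LinearMap.map_smul_of_tower, hx, smul_mul_smul_comm, smul_mul_smul_comm, mul_comm t s,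
    ← smul_sub, mul_smul_comm, smul_comm]

lemma localAt_commutatorVectors_congr [IsDedekindDomain R] {v : HeightOneSpectrum R}
    {o o' : Submodule R (CliffordAlgebra Q)}
    (h : localAt R (CliffordAlgebra Q) v o = localAt R (CliffordAlgebra Q) v o') :
    localAt R W v (commutatorVectors I Z o) = localAt R W v (commutatorVectors I Z o') :=
  le_antisymm
    (localAt_le_of_le (commutatorVectors_le_localAt (h ▸ le_localAt v o)))
    (localAt_le_of_le (commutatorVectors_le_localAt (h ▸ le_localAt v o')))

variable {γ : W ≃ₗ[F] W} {α : (CliffordAlgebra Q)ˣ}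

lemma latAction_commutatorVectors_le (h : IsTau F W Q γ α) (hZ : ∀ x, Z * x = x * Z)
    (o : Submodule R (CliffordAlgebra Q)) :
    latAction R F W γ (commutatorVectors I Z o) ≤
      commutatorVectors I Z (Submodule.map (conjMap R F W Q α) o) := by
  unfold latAction
  rw [Submodule.map_le_iff_le_comap]
  refine Submodule.span_le.2 ?_
  rintro x ⟨c, hc, a, ha, b, hb, hx⟩
  refine Submodule.subset_span ⟨c, hc, _, ⟨a, ha, rfl⟩, _, ⟨b, hb, rfl⟩, ?_⟩
  rw [← conjMap_mul, ← conjMap_mul, ← map_sub, conjMap_apply, ← mul_assoc Z, hZ, mul_assoc,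
    ← mul_assoc Z]
  change ι Q (γ x) = _
  rw [h x, hx, mul_smul_comm, smul_mul_assoc, mul_assoc]

/-- The formation of `commutatorVectors` is compatible with rotations. -/
lemma commutatorVectors_map (h : IsTau F W Q γ α) (hZ : ∀ x, Z * x = x * Z)
    (o : Submodule R (CliffordAlgebra Q)) :
    commutatorVectors I Z (Submodule.map (conjMap R F W Q α) o) =
      latAction R F W γ (commutatorVectors I Z o) := by
  refine le_antisymm (fun x hx => ?_) (latAction_commutatorVectors_le h hZ o)
  have := latAction_commutatorVectors_le (I := I) h.symm hZ _ (Submodule.mem_map_of_mem hx)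
  rw [map_conjMap_inv] at this
  exact ⟨_, this, γ.apply_symm_apply x⟩

/-- The localized form of the compatibility of `commutatorVectors` with rotations. -/
lemma localAt_commutatorVectors_eq [IsDedekindDomain R] (h : IsTau F W Q γ α)
    (hZ : ∀ x, Z * x = x * Z) {v : HeightOneSpectrum R} {o o' : Submodule R (CliffordAlgebra Q)}
    (ho : localAt R (CliffordAlgebra Q) v o' =
      Submodule.map (conjMap R F W Q α) (localAt R (CliffordAlgebra Q) v o)) :
    localAt R W v (commutatorVectors I Z o') =
      latAction R F W γ (localAt R W v (commutatorVectors I Z o)) := by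
  rw [← localAt_map v (conjMap R F W Q α) conjMap_bijective] at ho
  rw [localAt_commutatorVectors_congr ho, commutatorVectors_map h hZ]
  exact localAt_map v _ latAction_bijective _

end Vectors

end EvenOrder

end Paper

namespace Paper

open Module CliffordAlgebra IsDedekindDomain

section Recovery

variable {R F : Type*} [CommRing R] [IsDedekindDomain R] [Field F] [Algebra R F]
  [IsFractionRing R F]
variable {W : Type*} [AddCommGroup W] [Module F W] [Module R W] [IsScalarTower R F W]
variable {Q : QuadraticForm F W} {e : Basis (Fin 3) F W}

/-- The coefficients `c` such that `2κc` maps all the determinants of triples of vectors of `L`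
to integers. -/
def detColon (κ : F) (e : Basis (Fin 3) F W) (L : Submodule R W) : Set F :=
  {c | ∀ x ∈ L, ∀ y ∈ L, ∀ w ∈ L, ∃ r : R, algebraMap R F r = c * (2 * κ * e.det ![x, y, w])}

lemma exists_det_eq (f : Basis (Fin 3) F W) {m : Fin 3 → W}
    (hm : ∀ i, m i ∈ Submodule.span R (Set.range f)) :
    ∃ r : R, e.det m = algebraMap R F r * e.det f := by
  have hc : ∀ i j, ∃ r : R, algebraMap R F r = f.repr (m j) i := fun i j =>
    (f.mem_span_iff_repr_mem R (m j)).1 (hm j) i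
  choose r hr using hc
  refine ⟨Matrix.det (Matrix.of r), ?_⟩
  have h1 : f.det m = algebraMap R F (Matrix.det (Matrix.of r)) := by
    rw [f.det_apply, RingHom.map_det]
    congr 1
    ext i j
    exact (hr i j).symm
  rw [e.det.eq_smul_basis_det f]
  simp [h1, f.det_self, mul_comm]

section Commutators

variable (he : IsOrthogonalBasis Q e)
include he

omit [CommRing R] [IsDedekindDomain R] [Algebra R F] [IsFractionRing R F] [Module R W]
  [IsScalarTower R F W] in
lemma IsOrthogonalBasis.volElem_mul_commutator (x y w : W) :
    volElem Q e * ((ι Q x * ι Q y) * (ι Q x * ι Q w) - (ι Q x * ι Q w) * (ι Q x * ι Q y)) =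
      ι Q ((2 * (Q (e 0) * Q (e 1) * Q (e 2)) * e.det ![x, y, w]) • x) := by
  rw [commutator_mul_mul, he.tripleAlt_eq_smul, neg_mul, mul_smul_comm, ← he.volElem_comm,
    mul_neg, mul_smul_comm, ← mul_assoc, he.volElem_sq, Algebra.smul_def, ← mul_assoc, ← map_mul,
    ← Algebra.smul_def, map_smul, ← neg_smul]
  congr 1
  ring

/-- The product of the volume element with a commutator of two elements of the even span of `f`. -/
lemma IsOrthogonalBasis.exists_commutator_eq {T : Type*} [CommRing T] [Algebra T F] [Module T W]
    [IsScalarTower T F W] (f : Fin 3 → W) {a b : CliffordAlgebra Q}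
    (ha : a ∈ evenSpan T (ι Q (f 0)) (ι Q (f 1)) (ι Q (f 2)))
    (hb : b ∈ evenSpan T (ι Q (f 0)) (ι Q (f 1)) (ι Q (f 2))) :
    ∃ m : Fin 3 → T, volElem Q e * (a * b - b * a) =
      (2 * (Q (e 0) * Q (e 1) * Q (e 2)) * e.det f) • ι Q (∑ i, m i • f i) := by
  obtain ⟨a₀, a₁, a₂, a₃, rfl⟩ := mem_evenSpan.1 ha
  obtain ⟨b₀, b₁, b₂, b₃, rfl⟩ := mem_evenSpan.1 hb
  set u := ι Q (f 0) with hu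
  set v := ι Q (f 1) with hv
  set w := ι Q (f 2) with hw
  set κ := Q (e 0) * Q (e 1) * Q (e 2)
  have hd1 : e.det ![f 1, f 0, f 2] = - e.det f := by
    have : ![f 1, f 0, f 2] = f ∘ Equiv.swap 0 1 := by
      funext i; fin_cases i <;> rfl
    rw [this, e.det.map_swap f (by decide)]
  have hd2 : e.det ![f 2, f 0, f 1] = e.det f := by
    have : ![f 2, f 0, f 1] = (f ∘ Equiv.swap 0 1) ∘ Equiv.swap 0 2 := by
      funext i; fin_cases i <;> rfl
    rw [this, e.det.map_swap _ (by decide), e.det.map_swap f (by decide), neg_neg]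
  have hd0 : e.det ![f 0, f 1, f 2] = e.det f := by
    have : ![f 0, f 1, f 2] = f := by
      funext i; fin_cases i <;> rfl
    rw [this]
  have h0 := he.volElem_mul_commutator (f 0) (f 1) (f 2)
  have h1 := he.volElem_mul_commutator (f 1) (f 0) (f 2)
  have h2 := he.volElem_mul_commutator (f 2) (f 0) (f 1)
  rw [hd0] at h0
  rw [hd1] at h1
  rw [hd2] at h2
  simp only [← hu, ← hv, ← hw, map_smul] at h0 h1 h2
  have c1 : (v * u) * (v * w) - (v * w) * (v * u) = - ((u * v) * (v * w) - (v * w) * (u * v)) := by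
    have hvu : v * u = algebraMap F _ _ - u * v := ι_mul_ι_comm (f 1) (f 0)
    rw [hvu, sub_mul, mul_sub, Algebra.commutes _ (v * w)]
    abel
  have c2 : (w * u) * (w * v) - (w * v) * (w * u) = (u * w) * (v * w) - (v * w) * (u * w) := by
    have hwu : w * u = algebraMap F _ _ - u * w := ι_mul_ι_comm (f 2) (f 0)
    have hwv : w * v = algebraMap F _ _ - v * w := ι_mul_ι_comm (f 2) (f 1)
    rw [hwu, hwv]
    simp only [sub_mul, mul_sub]
    rw [Algebra.commutes _ (v * w), Algebra.commutes _ (u * w), Algebra.commutes _ (algebraMap F _ _)]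
    abel
  rw [c1] at h1
  rw [c2] at h2
  refine ⟨![a₁ * b₂ - a₂ * b₁, a₁ * b₃ - a₃ * b₁, a₂ * b₃ - a₃ * b₂], ?_⟩
  have key : (a₀ • (1 : CliffordAlgebra Q) + a₁ • (u * v) + a₂ • (u * w) + a₃ • (v * w)) *
      (b₀ • (1 : CliffordAlgebra Q) + b₁ • (u * v) + b₂ • (u * w) + b₃ • (v * w)) -
      (b₀ • (1 : CliffordAlgebra Q) + b₁ • (u * v) + b₂ • (u * w) + b₃ • (v * w)) *
      (a₀ • (1 : CliffordAlgebra Q) + a₁ • (u * v) + a₂ • (u * w) + a₃ • (v * w)) =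
      (a₁ * b₂ - a₂ * b₁) • ((u * v) * (u * w) - (u * w) * (u * v)) +
      (a₁ * b₃ - a₃ * b₁) • ((u * v) * (v * w) - (v * w) * (u * v)) +
      (a₂ * b₃ - a₃ * b₂) • ((u * w) * (v * w) - (v * w) * (u * w)) := by
    generalize u * v = X, u * w = Y, v * w = Z
    simp only [mul_add, add_mul, smul_mul_smul_comm, one_mul, mul_one]
    module
  rw [key]
  simp only [mul_add, mul_smul_comm]
  have h1' : volElem Q e * ((u * v) * (v * w) - (v * w) * (u * v)) = (2 * κ * e.det f) • v := by
    rw [← neg_inj, ← mul_neg, h1, mul_neg, neg_smul]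
  rw [h0, h1', h2]
  have hs : ∀ (c : T) (x : W), ι Q (c • x) = c • ι Q x := fun c x =>
    LinearMap.map_smul_of_tower _ _ _
  simp only [Fin.sum_univ_three, map_add, hs, Matrix.cons_val_zero, Matrix.cons_val_one,
    Matrix.cons_val, smul_add, ← hu, ← hv, ← hw]
  rw [smul_comm _ (2 * κ * e.det f) u, smul_comm _ (2 * κ * e.det f) v,
    smul_comm _ (2 * κ * e.det f) w]

end Commutators

end Recovery

end Paper

namespace Paper

open Module CliffordAlgebra IsDedekindDomain

section LocalRecovery

variable {R F : Type*} [CommRing R] [IsDedekindDomain R] [Field F] [Algebra R F]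
  [IsFractionRing R F]
variable {W : Type*} [AddCommGroup W] [Module F W] [Module R W] [IsScalarTower R F W]
variable {Q : QuadraticForm F W} {e : Basis (Fin 3) F W}
variable {v : HeightOneSpectrum R} {L : Submodule R W}

lemma map_mem_locRing (hQL : ∀ x ∈ L, Q x ∈ (algebraMap R F).range) {x : W}
    (hx : x ∈ localAt R W v L) : Q x ∈ locRing F v := by
  obtain ⟨s, hs, hsx⟩ := hx
  obtain ⟨r, hr⟩ := hQL _ hsx
  refine mem_locRing.2 ⟨s * s, notMem_mul hs hs, r, ?_⟩
  rw [hr, ← algebraMap_smul F, QuadraticMap.map_smul, map_mul, smul_eq_mul]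

lemma polar_mem_locRing (hQL : ∀ x ∈ L, Q x ∈ (algebraMap R F).range) {x y : W}
    (hx : x ∈ localAt R W v L) (hy : y ∈ localAt R W v L) :
    QuadraticMap.polar Q x y ∈ locRing F v :=
  sub_mem (sub_mem (map_mem_locRing hQL (add_mem hx hy)) (map_mem_locRing hQL hx))
    (map_mem_locRing hQL hy)

lemma APlusSub_mem_evenSpan (hQL : ∀ x ∈ L, Q x ∈ (algebraMap R F).range)
    {f : Basis (Fin 3) F W} (hf : ∀ i, f i ∈ localAt R W v L)
    (hrepr : ∀ x ∈ localAt R W v L, ∀ i, f.repr x i ∈ locRing F v)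
    {a : CliffordAlgebra Q} (ha : a ∈ APlusSub R F W Q L) :
    a ∈ evenSpan (locRing F v) (ι Q (f 0)) (ι Q (f 1)) (ι Q (f 2)) := by
  rw [mem_APlusSub] at ha
  refine (mem_evenSpan_of_mem_even (T := locRing F v)
    (fun i => ⟨⟨_, map_mem_locRing hQL (hf i)⟩, rfl⟩)
    (fun i j => ⟨⟨_, polar_mem_locRing hQL (hf i) (hf j)⟩, rfl⟩) ?_).1 ha.1
  obtain ⟨-, ha⟩ := ha
  induction ha using Algebra.adjoin_induction with
  | mem _ hg =>
    obtain ⟨y, hy, rfl⟩ := hg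
    rw [← f.sum_repr y, map_sum]
    refine sum_mem fun i _ => ?_
    have hi := hrepr y (le_localAt v L hy) i
    rw [map_smul]
    exact Subalgebra.smul_mem (Algebra.adjoin (locRing F v) (ι Q '' Set.range f))
      (Algebra.subset_adjoin ⟨_, ⟨i, rfl⟩, rfl⟩) ⟨_, hi⟩
  | algebraMap r =>
    have := Subalgebra.algebraMap_mem
      (Algebra.adjoin (locRing F v) (ι Q '' Set.range f)) (algebraMap R (locRing F v) r)
    exact this
  | add a b _ _ ha hb => exact add_mem ha hb
  | mul a b _ _ ha hb => exact mul_mem ha hb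

lemma exists_common_smul_mem {n : ℕ} {f : Fin n → W} (hf : ∀ i, f i ∈ localAt R W v L) :
    ∃ t : R, t ∉ v.asIdeal ∧ ∀ i, t • f i ∈ L := by
  obtain ⟨t, ht, h⟩ := exists_smul_le_of_fg (N := Submodule.span R (Set.range f))
    (Submodule.fg_span (Set.finite_range f))
    (Submodule.span_le.2 (Set.range_subset_iff.2 hf))
  exact ⟨t, ht, fun i => h _ (Submodule.subset_span ⟨i, rfl⟩)⟩

omit [CommRing R] [IsDedekindDomain R] [Algebra R F] [IsFractionRing R F] [Module R W]
  [IsScalarTower R F W] in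
lemma exists_det_cyclic (f : Fin 3 → W) (i : Fin 3) :
    ∃ j k, e.det ![f i, f j, f k] = e.det f := by
  have h : ∀ a b c d : Fin 3, a ≠ b → c ≠ d →
      e.det ((f ∘ Equiv.swap a b) ∘ Equiv.swap c d) = e.det f := fun a b c d hab hcd => by
    rw [e.det.map_swap _ hcd, e.det.map_swap f hab, neg_neg]
  fin_cases i
  · refine ⟨1, 2, congrArg _ ?_⟩
    funext i; fin_cases i <;> rfl
  · refine ⟨2, 0, ?_⟩
    rw [← h 0 1 1 2 (by decide) (by decide)]
    refine congrArg _ ?_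
    funext i; fin_cases i <;> rfl
  · refine ⟨0, 1, ?_⟩
    rw [← h 0 1 0 2 (by decide) (by decide)]
    refine congrArg _ ?_
    funext i; fin_cases i <;> rfl

lemma detColon_mul_mem_locRing {κ c : F} (hc : c ∈ detColon κ e L) {f : Fin 3 → W}
    (hf : ∀ i, f i ∈ localAt R W v L) : c * (2 * κ * e.det f) ∈ locRing F v := by
  obtain ⟨t, ht, htf⟩ := exists_common_smul_mem hf
  obtain ⟨r, hr⟩ := hc _ (htf 0) _ (htf 1) _ (htf 2)
  refine mem_locRing.2 ⟨t * t * t, notMem_mul (notMem_mul ht ht) ht, r, ?_⟩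
  have h1 : ![t • f 0, t • f 1, t • f 2] = fun i => algebraMap R F t • f i := by
    funext i; fin_cases i <;> simp
  have h2 := e.det.map_smul_univ (fun _ => algebraMap R F t) f
  simp only [Fin.prod_univ_three, smul_eq_mul] at h2
  rw [hr, h1, h2, map_mul, map_mul]
  ring

lemma exists_detColon_mem {κ : F} (hκ : κ ≠ 0) [CharZero F] (hL : L.FG) {f : Basis (Fin 3) F W}
    (hrepr : ∀ x ∈ localAt R W v L, ∀ i, f.repr x i ∈ locRing F v) :
    ∃ s : R, s ∉ v.asIdeal ∧
      algebraMap R F s * (2 * κ * e.det f)⁻¹ ∈ detColon κ e L := by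
  have hle : L ≤ localAt R W v (Submodule.span R (Set.range f)) := by
    intro x hx
    rw [← f.sum_repr x]
    exact sum_mem fun i _ => smul_mem_localAt (hrepr x (le_localAt v L hx) i)
      (le_localAt v _ (Submodule.subset_span ⟨i, rfl⟩))
  obtain ⟨s, hs, h⟩ := exists_smul_le_of_fg hL hle
  refine ⟨s * s * s, notMem_mul (notMem_mul hs hs) hs, fun x hx y hy w hw => ?_⟩
  have hmem : ∀ i, ![s • x, s • y, s • w] i ∈ Submodule.span R (Set.range f) := by
    intro i
    fin_cases i
    exacts [h x hx, h y hy, h w hw]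
  obtain ⟨r, hr⟩ := exists_det_eq (e := e) f hmem
  have h1 : ![s • x, s • y, s • w] = fun i => algebraMap R F s • ![x, y, w] i := by
    funext i; fin_cases i <;> simp
  have h2 := e.det.map_smul_univ (fun _ => algebraMap R F s) ![x, y, w]
  simp only [Fin.prod_univ_three, smul_eq_mul] at h2
  rw [h1, h2] at hr
  have hd : e.det f ≠ 0 := (e.isUnit_det f).ne_zero
  refine ⟨r, ?_⟩
  rw [map_mul, map_mul]
  field_simp
  linear_combination -hr

variable [CharZero F] (he : IsOrthogonalBasis Q e)
include he

/-- Up to localization, a lattice is recovered from its even Clifford order. -/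
theorem localAt_commutatorVectors_APlusSub (hL : IsLat R F W L)
    (hQL : ∀ x ∈ L, Q x ∈ (algebraMap R F).range) :
    localAt R W v (commutatorVectors (detColon (Q (e 0) * Q (e 1) * Q (e 2)) e L) (volElem Q e)
      (APlusSub R F W Q L)) = localAt R W v L := by
  have : FiniteDimensional F W := Module.Finite.of_basis e
  have hn : finrank F W = 3 := by rw [finrank_eq_card_basis e]; rfl
  obtain ⟨f, hf, hrepr⟩ := exists_local_basis v hn hL
  set κ := Q (e 0) * Q (e 1) * Q (e 2) with hκ
  have hκ0 : κ ≠ 0 := by simp [hκ, he.ne_zero]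
  have hd : e.det f ≠ 0 := (e.isUnit_det f).ne_zero
  refine le_antisymm (localAt_le_of_le (Submodule.span_le.2 ?_)) (localAt_le_of_le fun x hx => ?_)
  · rintro x ⟨c, hc, a, ha, b, hb, hx⟩
    obtain ⟨m, hm⟩ := he.exists_commutator_eq (T := locRing F v) f
      (APlusSub_mem_evenSpan hQL hf hrepr ha) (APlusSub_mem_evenSpan hQL hf hrepr hb)
    rw [hm, smul_smul, ← map_smul] at hx
    rw [clifford_ι_injective hx]
    exact smul_mem_localAt (detColon_mul_mem_locRing hc hf)
      (sum_mem fun i _ => smul_mem_localAt (m i).2 (hf i))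
  · rw [← f.sum_repr x]
    refine sum_mem fun i _ => smul_mem_localAt (hrepr x (le_localAt v L hx) i) ?_
    obtain ⟨s, hs, hsc⟩ := exists_detColon_mem (e := e) hκ0 hL.1 hrepr
    obtain ⟨t, ht, htf⟩ := exists_common_smul_mem hf
    obtain ⟨j, k, hjk⟩ := exists_det_cyclic (e := e) f i
    refine ⟨s * (t * t * t * t), notMem_mul hs (notMem_mul (notMem_mul (notMem_mul ht ht) ht) ht),
      Submodule.subset_span ⟨_, hsc, (ι Q (t • f i)) * ι Q (t • f j), ?_,
        (ι Q (t • f i)) * ι Q (t • f k), ?_, ?_⟩⟩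
    · exact ⟨ι_mul_ι_mem_evenOdd_zero Q _ _, mul_mem (Algebra.subset_adjoin ⟨_, htf i, rfl⟩)
        (Algebra.subset_adjoin ⟨_, htf j, rfl⟩)⟩
    · exact ⟨ι_mul_ι_mem_evenOdd_zero Q _ _, mul_mem (Algebra.subset_adjoin ⟨_, htf i, rfl⟩)
        (Algebra.subset_adjoin ⟨_, htf k, rfl⟩)⟩
    · rw [he.volElem_mul_commutator, ← (ι Q).map_smul]
      refine congrArg _ ?_
      have h1 : ![t • f i, t • f j, t • f k] = fun l => algebraMap R F t • ![f i, f j, f k] l := by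
        funext i; fin_cases i <;> simp
      have h2 := e.det.map_smul_univ (fun _ => algebraMap R F t) ![f i, f j, f k]
      simp only [Fin.prod_univ_three, smul_eq_mul] at h2
      rw [h1, h2, hjk, ← hκ, ← algebraMap_smul F, ← algebraMap_smul F t (f i), smul_smul, smul_smul]
      congr 1
      simp only [map_mul]
      field_simp

end LocalRecovery

end Paper

namespace Paper

open Module CliffordAlgebra IsDedekindDomain

section ClassBijection

variable {R F : Type*} [CommRing R] [IsDedekindDomain R] [Field F] [CharZero F] [Algebra R F]
  [IsFractionRing R F]
variable {W : Type*} [AddCommGroup W] [Module F W] [Module R W] [IsScalarTower R F W]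
variable {ψ : LinearMap.BilinForm F W}

omit [CommRing R] [IsDedekindDomain R] [Algebra R F] [IsFractionRing R F] [Module R W]
  [IsScalarTower R F W] in
lemma isSOElem_iff (hψ : ψ.IsSymm) {γ : W ≃ₗ[F] W} : IsSOElem F W ψ γ ↔
    (∀ x, LinearMap.BilinMap.toQuadraticMap ψ (γ x) = LinearMap.BilinMap.toQuadraticMap ψ x) ∧
      LinearMap.det (γ : W →ₗ[F] W) = 1 := by
  refine and_congr_left fun _ => ⟨fun h x => h x x, fun h x y => ?_⟩
  have hp : ∀ z, ψ (γ z) (γ z) = ψ z z := h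
  have h1 := hp (x + y)
  simp only [map_add, LinearMap.add_apply, hp] at h1
  have h2 : ψ (γ y) (γ x) = ψ (γ x) (γ y) := hψ.eq _ _
  have h3 : ψ y x = ψ x y := hψ.eq _ _
  rw [h2, h3] at h1
  have h4 : (2 : F) * (ψ (γ x) (γ y) - ψ x y) = 0 := by linear_combination h1
  exact sub_eq_zero.1 ((mul_eq_zero.1 h4).resolve_left two_ne_zero)

omit [CommRing R] [IsDedekindDomain R] [Algebra R F] [IsFractionRing R F] [Module R W]
  [IsScalarTower R F W] [CharZero F] in
lemma IsSOElem.symm {γ : W ≃ₗ[F] W} (h : IsSOElem F W ψ γ) : IsSOElem F W ψ γ.symm := by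
  refine ⟨fun x y => ?_, ?_⟩
  · rw [← h.1, γ.apply_symm_apply, γ.apply_symm_apply]
  · have := LinearEquiv.det_mul_det_symm γ
    rwa [h.2, one_mul] at this

omit [IsDedekindDomain R] [CharZero F] [IsFractionRing R F] in
lemma eq_latAction_symm {γ : W ≃ₗ[F] W} {N N' : Submodule R W} (h : latAction R F W γ N = N') :
    N = latAction R F W γ.symm N' := by
  rw [← h, latAction_symm_latAction]

/-- The recovery of a lattice from its even Clifford order. -/
def evenOrderVectors (ψ : LinearMap.BilinForm F W) (e : Basis (Fin 3) F W) (L : Submodule R W)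
    (o : Submodule R (CliffordAlgebra (LinearMap.BilinMap.toQuadraticMap ψ))) : Submodule R W :=
  commutatorVectors (detColon (ψ (e 0) (e 0) * ψ (e 1) (e 1) * ψ (e 2) (e 2)) e L)
    (volElem (LinearMap.BilinMap.toQuadraticMap ψ) e) o

variable {e : Basis (Fin 3) F W}
  (he : IsOrthogonalBasis (LinearMap.BilinMap.toQuadraticMap ψ) e) {L : Submodule R W}
include he

lemma localAt_evenOrderVectors_APlusSub (hL : IsIntegralLat R F W ψ L) (v : HeightOneSpectrum R) :
    localAt R W v (evenOrderVectors ψ e L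
      (APlusSub R F W (LinearMap.BilinMap.toQuadraticMap ψ) L)) = localAt R W v L :=
  localAt_commutatorVectors_APlusSub he hL.1 hL.2

lemma InGenus.exists_local (hψ : ψ.IsSymm) (hL : IsIntegralLat R F W ψ L) {N : Submodule R W}
    (hN : InGenus R F W ψ L N) (v : HeightOneSpectrum R) :
    (∃ α : (CliffordAlgebra (LinearMap.BilinMap.toQuadraticMap ψ))ˣ,
      IsGPlusUnit F W (LinearMap.BilinMap.toQuadraticMap ψ) α ∧
      Submodule.map (conjMap R F W _ α) (localAt R _ v
        (APlusSub R F W (LinearMap.BilinMap.toQuadraticMap ψ) L)) =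
      localAt R _ v (APlusSub R F W (LinearMap.BilinMap.toQuadraticMap ψ) N)) ∧
    localAt R W v (evenOrderVectors ψ e L
      (APlusSub R F W (LinearMap.BilinMap.toQuadraticMap ψ) N)) = localAt R W v N := by
  obtain ⟨γ, hγ, hγN⟩ := hN v
  have hγN' := eq_latAction_symm hγN
  obtain ⟨hQ, hdet⟩ := (isSOElem_iff hψ).1 hγ.symm
  obtain ⟨α, hα, hτ⟩ := exists_isTau he hQ hdet
  have h1 := localAt_APlusSub_eq_map hτ hα hγN'
  refine ⟨⟨α, hα, h1.symm⟩, ?_⟩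
  have h2 := localAt_commutatorVectors_eq
    (I := detColon (ψ (e 0) (e 0) * ψ (e 1) (e 1) * ψ (e 2) (e 2)) e L) hτ he.volElem_comm h1
  exact h2.trans (by
    rw [hγN']
    exact congrArg _ (localAt_evenOrderVectors_APlusSub he hL v))

lemma OrderInGenus.exists_local (hψ : ψ.IsSymm) (hL : IsIntegralLat R F W ψ L)
    {o : Submodule R (CliffordAlgebra (LinearMap.BilinMap.toQuadraticMap ψ))}
    (ho : OrderInGenus R F W (LinearMap.BilinMap.toQuadraticMap ψ)
      (APlusSub R F W (LinearMap.BilinMap.toQuadraticMap ψ) L) o) (v : HeightOneSpectrum R) :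
    (∃ γ : W ≃ₗ[F] W, IsSOElem F W ψ γ ∧
      latAction R F W γ (localAt R W v (evenOrderVectors ψ e L o)) = localAt R W v L) ∧
    localAt R _ v (APlusSub R F W (LinearMap.BilinMap.toQuadraticMap ψ)
      (evenOrderVectors ψ e L o)) = localAt R _ v o := by
  obtain ⟨α, hα, hαo⟩ := ho v
  obtain ⟨γ, hQ, hdet, hτ⟩ := exists_isTau_of_isGPlusUnit he hα
  have h1 : localAt R W v (evenOrderVectors ψ e L o) = latAction R F W γ (localAt R W v L) :=
    (localAt_commutatorVectors_eq hτ he.volElem_comm hαo.symm).trans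
      (congrArg _ (localAt_evenOrderVectors_APlusSub he hL v))
  refine ⟨⟨γ.symm, ((isSOElem_iff hψ).2 ⟨hQ, hdet⟩).symm, ?_⟩, ?_⟩
  · rw [h1, latAction_symm_latAction]
  · rw [← hαo, localAt_APlusSub_eq_map hτ hα h1]

/-- The lattices in the genus of `L` correspond to the orders in the genus of `A⁺(L)`. -/
def genusEquiv (hψ : ψ.IsSymm) (hR : ¬ IsField R) (hL : IsIntegralLat R F W ψ L) :
    {N : Submodule R W // InGenus R F W ψ L N} ≃
      {o : Submodule R (CliffordAlgebra (LinearMap.BilinMap.toQuadraticMap ψ)) //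
        OrderInGenus R F W (LinearMap.BilinMap.toQuadraticMap ψ)
          (APlusSub R F W (LinearMap.BilinMap.toQuadraticMap ψ) L) o} where
  toFun N := ⟨APlusSub R F W (LinearMap.BilinMap.toQuadraticMap ψ) N.1,
    fun v => (InGenus.exists_local he hψ hL N.2 v).1⟩
  invFun o := ⟨evenOrderVectors ψ e L o.1, fun v => (OrderInGenus.exists_local he hψ hL o.2 v).1⟩
  left_inv N := Subtype.ext (eq_of_localAt_eq hR fun v =>
    (InGenus.exists_local he hψ hL N.2 v).2)
  right_inv o := Subtype.ext (eq_of_localAt_eq hR fun v =>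
    (OrderInGenus.exists_local he hψ hL o.2 v).2)

lemma genusEquiv_rel_iff (hψ : ψ.IsSymm) (hR : ¬ IsField R) (hL : IsIntegralLat R F W ψ L)
    (N N' : {N : Submodule R W // InGenus R F W ψ L N}) :
    (∃ γ : W ≃ₗ[F] W, IsSOElem F W ψ γ ∧ latAction R F W γ N.1 = N'.1) ↔
      ∃ α : (CliffordAlgebra (LinearMap.BilinMap.toQuadraticMap ψ))ˣ,
        IsGPlusUnit F W (LinearMap.BilinMap.toQuadraticMap ψ) α ∧
        Submodule.map (conjMap R F W _ α) (genusEquiv he hψ hR hL N).1 =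
          (genusEquiv he hψ hR hL N').1 := by
  constructor
  · rintro ⟨γ, hγ, h⟩
    obtain ⟨hQ, hdet⟩ := (isSOElem_iff hψ).1 hγ
    obtain ⟨α, hα, hτ⟩ := exists_isTau he hQ hdet
    exact ⟨α, hα, (map_conjMap_APlusSub hτ hα N.1).trans (congrArg _ h)⟩
  · rintro ⟨α, hα, h⟩
    obtain ⟨γ, hQ, hdet, hτ⟩ := exists_isTau_of_isGPlusUnit he hα
    refine ⟨γ, (isSOElem_iff hψ).2 ⟨hQ, hdet⟩, ?_⟩
    have h1 : ∀ M, evenOrderVectors ψ e L (genusEquiv he hψ hR hL M).1 = M.1 := fun M =>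
      congrArg Subtype.val ((genusEquiv he hψ hR hL).symm_apply_apply M)
    rw [← h1 N', ← h]
    conv_lhs => rw [← h1 N]
    exact (commutatorVectors_map hτ he.volElem_comm _).symm

/-- The classes in the genus of `L` correspond to the conjugacy classes in the genus of `A⁺(L)`. -/
theorem exists_class_equiv (hψ : ψ.IsSymm) (hR : ¬ IsField R) (hL : IsIntegralLat R F W ψ L) :
    ∃ f : Quot (fun (N N' : {N : Submodule R W // InGenus R F W ψ L N}) =>
        ∃ γ : W ≃ₗ[F] W, IsSOElem F W ψ γ ∧ latAction R F W γ N.1 = N'.1) ≃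
      Quot (fun (o o' : {o : Submodule R (CliffordAlgebra (LinearMap.BilinMap.toQuadraticMap ψ)) //
          OrderInGenus R F W (LinearMap.BilinMap.toQuadraticMap ψ)
            (APlusSub R F W (LinearMap.BilinMap.toQuadraticMap ψ) L) o}) =>
        ∃ α : (CliffordAlgebra (LinearMap.BilinMap.toQuadraticMap ψ))ˣ,
          IsGPlusUnit F W (LinearMap.BilinMap.toQuadraticMap ψ) α ∧
          Submodule.map (conjMap R F W (LinearMap.BilinMap.toQuadraticMap ψ) α) o.1 = o'.1),
      ∀ (N : Submodule R W) (hN : InGenus R F W ψ L N)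
        (ho : OrderInGenus R F W (LinearMap.BilinMap.toQuadraticMap ψ)
          (APlusSub R F W (LinearMap.BilinMap.toQuadraticMap ψ) L)
          (APlusSub R F W (LinearMap.BilinMap.toQuadraticMap ψ) N)),
        f (Quot.mk _ ⟨N, hN⟩) =
          Quot.mk _ ⟨APlusSub R F W (LinearMap.BilinMap.toQuadraticMap ψ) N, ho⟩ :=
  ⟨Quot.congr (genusEquiv he hψ hR hL) (genusEquiv_rel_iff he hψ hR hL), fun _ _ _ => rfl⟩

end ClassBijection

end Paper

namespace Paper

open Module IsDedekindDomain

section Hyperplane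

section Orthogonal

variable {F V : Type*} [Field F] [AddCommGroup V] [Module F V]

lemma separatingLeft_restrict_ker_flip {φ : LinearMap.BilinForm F V}
    (hnd : φ.SeparatingLeft) {h : V} (hh : φ h h ≠ 0) :
    (φ.restrict (LinearMap.ker (φ.flip h))).SeparatingLeft := by
  rintro ⟨x, hx⟩ hx0
  have hxh : φ x h = 0 := hx
  refine Subtype.ext (hnd x fun y => ?_)
  have hy : y - (φ y h / φ h h) • h ∈ LinearMap.ker (φ.flip h) := by
    simp [LinearMap.mem_ker, hh]
  have h1 : φ x (y - (φ y h / φ h h) • h) = 0 := hx0 ⟨_, hy⟩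
  simpa [hxh] using h1

/-- A three-dimensional separating symmetric form has an orthogonal basis. -/
lemma exists_isOrthogonalBasis [CharZero F] {ψ : LinearMap.BilinForm F V} (hψ : ψ.IsSymm)
    (hnd : ψ.SeparatingLeft) (h3 : finrank F V = 3) :
    ∃ e : Basis (Fin 3) F V, IsOrthogonalBasis (LinearMap.BilinMap.toQuadraticMap ψ) e := by
  have : FiniteDimensional F V := FiniteDimensional.of_finrank_pos (by omega)
  have : Invertible (2 : F) := invertibleOfNonzero two_ne_zero
  obtain ⟨v, hv⟩ := LinearMap.BilinForm.exists_orthogonal_basis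
    (LinearMap.BilinForm.isSymm_iff.1 hψ)
  refine ⟨v.reindex (finCongr h3), fun i j hij => ?_, fun i => ?_⟩
  · have hne : (finCongr h3).symm i ≠ (finCongr h3).symm j := (finCongr h3).symm.injective.ne hij
    have h1 := LinearMap.isOrthoᵢ_def.1 hv _ _ hne
    have h2 := LinearMap.isOrthoᵢ_def.1 hv _ _ hne.symm
    rw [LinearMap.BilinMap.polar_toQuadraticMap, Basis.reindex_apply, Basis.reindex_apply, h1, h2,
      add_zero]
  · simpa using hv.not_isOrtho_basis_self_of_separatingLeft hnd ((finCongr h3).symm i)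

end Orthogonal

section Lattice

variable {R F V : Type*} [CommRing R] [IsDomain R] [Field F] [Algebra R F] [IsFractionRing R F]
  [AddCommGroup V] [Module F V] [Module R V] [IsScalarTower R F V]

lemma exists_smul_mem_of_mem_span {L : Submodule R V} {x : V}
    (hx : x ∈ Submodule.span F (L : Set V)) : ∃ r : R, r ≠ 0 ∧ r • x ∈ L := by
  induction hx using Submodule.span_induction with
  | mem x hx => exact ⟨1, one_ne_zero, by simpa using hx⟩
  | zero => exact ⟨1, one_ne_zero, by simp⟩
  | add x y _ _ hx hy =>
    obtain ⟨r, hr, hx⟩ := hx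
    obtain ⟨s, hs, hy⟩ := hy
    refine ⟨r * s, mul_ne_zero hr hs, ?_⟩
    rw [smul_add]
    refine L.add_mem ?_ ?_
    · rw [mul_comm, mul_smul]; exact L.smul_mem s hx
    · rw [mul_smul]; exact L.smul_mem r hy
  | smul a x _ hx =>
    obtain ⟨r, hr, hx⟩ := hx
    obtain ⟨m, n, hn, rfl⟩ := IsFractionRing.div_surjective (A := R) a
    refine ⟨n * r, mul_ne_zero (nonZeroDivisors.ne_zero hn) hr, ?_⟩
    have hn' : algebraMap R F n ≠ 0 :=
      IsFractionRing.to_map_ne_zero_of_mem_nonZeroDivisors hn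
    have : (n * r) • (algebraMap R F m / algebraMap R F n) • x = m • r • x := by
      rw [← algebraMap_smul F (n * r), ← algebraMap_smul F m, ← algebraMap_smul F r x, smul_smul,
        smul_smul, map_mul]
      congr 1
      field_simp
    rw [this]
    exact L.smul_mem m hx

variable (W : Submodule F V)

lemma IsIntegralLat.comap_subtype [IsNoetherianRing R] {φ : LinearMap.BilinForm F V}
    {L : Submodule R V} (hL : IsIntegralLat R F V φ L) :
    IsIntegralLat R F W (φ.restrict W) (Submodule.comap (W.subtype.restrictScalars R) L) := by
  refine ⟨⟨?_, ?_⟩, fun x hx => hL.2 x hx⟩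
  · have := isNoetherian_of_fg_of_noetherian L hL.1.1
    refine Submodule.fg_of_fg_map_injective (W.subtype.restrictScalars R)
      Subtype.val_injective ?_
    exact Submodule.FG.of_le hL.1.1 (Submodule.map_comap_le _ _)
  · refine eq_top_iff.2 fun w _ => ?_
    obtain ⟨r, hr, hrw⟩ := exists_smul_mem_of_mem_span (F := F) (L := L) (x := (w : V))
      (hL.1.2 ▸ Submodule.mem_top)
    have hr' : algebraMap R F r ≠ 0 := by simpa using hr
    rw [← inv_smul_smul₀ hr' w]
    refine Submodule.smul_mem _ _ (Submodule.subset_span ?_)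
    change ((algebraMap R F r • w : W) : V) ∈ L
    rwa [Submodule.coe_smul, algebraMap_smul]

end Lattice

end Hyperplane

lemma not_isField_of_isIntegralClosure (R F : Type*) [CommRing R] [Field F] [CharZero F]
    [Algebra R F] [IsIntegralClosure R ℤ F] : ¬ IsField R := by
  intro hR
  have hinj : Function.Injective (algebraMap R F) := IsIntegralClosure.algebraMap_injective R ℤ F
  have h2 : (2 : R) ≠ 0 := fun h => two_ne_zero (α := F) (by
    simpa only [map_ofNat, map_zero] using congrArg (algebraMap R F) h)
  obtain ⟨b, hb⟩ := hR.mul_inv_cancel h2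
  have hb' : 2 * algebraMap R F b = 1 := by
    simpa only [map_mul, map_ofNat, map_one] using congrArg (algebraMap R F) hb
  have hQL : IsIntegral ℤ (algebraMap R F b) :=
    IsIntegralClosure.isIntegral_iff (A := R).2 ⟨b, rfl⟩
  have hq : algebraMap R F b = algebraMap ℚ F (1 / 2) := by
    simp only [one_div, map_inv₀, map_ofNat]
    exact eq_inv_of_mul_eq_one_right hb'
  rw [hq, isIntegral_algebraMap_iff (algebraMap ℚ F).injective] at hQL
  obtain ⟨n, hn⟩ := IsIntegrallyClosed.isIntegral_iff.1 hQL
  have : (n : ℚ) * 2 = 1 := by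
    rw [show (n : ℚ) = 1 / 2 from hn]; norm_num
  have : n * 2 = 1 := by exact_mod_cast this
  omega

end Paper

open Paper NumberField IsDedekindDomain

section

variable (F : Type*) [Field F] [NumberField F]
variable (R : Type*) [CommRing R] [IsDedekindDomain R] [Algebra R F] [IsFractionRing R F]
  [IsIntegralClosure R ℤ F]
variable (V : Type*) [AddCommGroup V] [Module F V] [Module R V] [IsScalarTower R F V]

set_option synthInstance.maxHeartbeats 1000000 in
set_option maxHeartbeats 1000000 in
/-- The map `N ↦ A⁺(N)` induces a bijection from the set of
`SO^ψ`-classes contained in the `SO^ψ`-genus of `L∩W` onto the set of conjugacy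
classes (under `A⁺(W)ˣ`) contained in the genus of `𝔬 = A⁺(L∩W)`. -/
theorem statement8
    (hV : Module.finrank F V = 4)
    (φ : LinearMap.BilinForm F V) (hsymm : φ.IsSymm)
    (hnd : LinearMap.BilinForm.Nondegenerate φ)
    (h : V) (hq : φ h h ≠ 0)
    (Wsub : Submodule F V) (hWsub : Wsub = LinearMap.ker (φ.flip h))
    (L : Submodule R V) (hL : IsMaximalLat R F V φ L) :
    ∃ f : Quot (fun (N N' : {N : Submodule R ↥Wsub //
          InGenus R F ↥Wsub (LinearMap.BilinForm.restrict φ Wsub) (Submodule.comap ((Wsub.subtype).restrictScalars R) L) N}) =>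
        ∃ γ : ↥Wsub ≃ₗ[F] ↥Wsub, IsSOElem F ↥Wsub (LinearMap.BilinForm.restrict φ Wsub) γ ∧
          latAction R F ↥Wsub γ N.1 = N'.1) ≃
      Quot (fun (o o' : {o : Submodule R (CliffordAlgebra (LinearMap.BilinMap.toQuadraticMap (LinearMap.BilinForm.restrict φ Wsub))) //
          OrderInGenus R F ↥Wsub (LinearMap.BilinMap.toQuadraticMap (LinearMap.BilinForm.restrict φ Wsub)) (APlusSub R F ↥Wsub (LinearMap.BilinMap.toQuadraticMap (LinearMap.BilinForm.restrict φ Wsub)) (Submodule.comap ((Wsub.subtype).restrictScalars R) L)) o}) =>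
        ∃ α : (CliffordAlgebra (LinearMap.BilinMap.toQuadraticMap (LinearMap.BilinForm.restrict φ Wsub)))ˣ, IsGPlusUnit F ↥Wsub (LinearMap.BilinMap.toQuadraticMap (LinearMap.BilinForm.restrict φ Wsub)) α ∧
          Submodule.map (conjMap R F ↥Wsub (LinearMap.BilinMap.toQuadraticMap (LinearMap.BilinForm.restrict φ Wsub)) α) o.1 = o'.1),
      ∀ (N : Submodule R ↥Wsub)
        (hN : InGenus R F ↥Wsub (LinearMap.BilinForm.restrict φ Wsub) (Submodule.comap ((Wsub.subtype).restrictScalars R) L) N)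
        (ho : OrderInGenus R F ↥Wsub (LinearMap.BilinMap.toQuadraticMap (LinearMap.BilinForm.restrict φ Wsub)) (APlusSub R F ↥Wsub (LinearMap.BilinMap.toQuadraticMap (LinearMap.BilinForm.restrict φ Wsub)) (Submodule.comap ((Wsub.subtype).restrictScalars R) L))
          (APlusSub R F ↥Wsub (LinearMap.BilinMap.toQuadraticMap (LinearMap.BilinForm.restrict φ Wsub)) N)),
        f (Quot.mk _ ⟨N, hN⟩) = Quot.mk _ ⟨APlusSub R F ↥Wsub (LinearMap.BilinMap.toQuadraticMap (LinearMap.BilinForm.restrict φ Wsub)) N, ho⟩ := by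
  have hker : Module.finrank F Wsub = 3 := by
    have : FiniteDimensional F V := FiniteDimensional.of_finrank_pos (by omega)
    have h1 := Module.Dual.finrank_ker_add_one_of_ne_zero (f := φ.flip h)
      fun h0 => hq (LinearMap.congr_fun h0 h)
    rw [hWsub]
    omega
  have hψ := hsymm.restrict Wsub
  obtain ⟨e, he⟩ := exists_isOrthogonalBasis hψ
    (hWsub ▸ separatingLeft_restrict_ker_flip hnd.1 hq) hker
  exact exists_class_equiv he hψ (not_isField_of_isIntegralClosure R F) (hL.1.comap_subtype Wsub)

end
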